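/- arXiv:2204.00165 — 4 statements merged into one kernel-verified Lean document; each statement's English description precedes it below -/
import Mathlib

section
/- For each permutation σ of [n], the number of nonnesting permutations π with first-copy subsequence σ and des(π) - des(σ) = r equals the number of those with des(π) - des(σ) = n - 1 - r, for all r. -/
attribute [local instance] Classical.propDecidable

/-- The word 1^k 2^k ... n^k. -/
def baseWord (n k : ℕ) : List ℕ := (List.range n).flatMap (fun i => List.replicate k (i+1))

/-- All permutations of the multiset with k copies of each of 1,...,n. -/
noncomputable def multiPerms (n k : ℕ) : Finset (List ℕ) := (baseWord n k).permutations.toFinset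

/-- Number of descents of a word. -/
def des (w : List ℕ) : ℕ := ((w.zip w.tail).filter (fun p => decide (p.2 < p.1))).length
/-- Number of plateaus of a word. -/
def plat (w : List ℕ) : ℕ := ((w.zip w.tail).filter (fun p => decide (p.2 = p.1))).length
/-- Number of weak descents of a word. -/
def wdes (w : List ℕ) : ℕ := ((w.zip w.tail).filter (fun p => decide (p.2 ≤ p.1))).length

/-- Avoidance of the patterns 1221 and 2112: there are no positions i < j < l < m with
w_i = w_m, w_j = w_l and w_i ≠ w_j. -/
def avoids (w : List ℕ) : Prop := ∀ i j l m, i < j → j < l → l < m → m < w.length →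
  w.getD i 0 = w.getD m 0 → w.getD j 0 = w.getD l 0 → w.getD i 0 = w.getD j 0

/-- Nonnesting permutations of the multiset {1,1,...,n,n}. -/
noncomputable def nonnest (n : ℕ) : Finset (List ℕ) := (multiPerms n 2).filter avoids

open Finset in
/-- number of descents of `s` at positions `< i` -/
noncomputable def dcnt {N : ℕ} {α : Type*} [LinearOrder α] (s : Fin N → α) (i : ℕ) : ℤ :=
  ∑ j ∈ Finset.range i, if ∃ h : j + 1 < N, s ⟨j+1, h⟩ < s ⟨j, by omega⟩ then 1 else 0

theorem dcnt_zero {N : ℕ} {α : Type*} [LinearOrder α] (s : Fin N → α) : dcnt s 0 = 0 := by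
  simp [dcnt]

theorem dcnt_mono {N : ℕ} {α : Type*} [LinearOrder α] (s : Fin N → α) : Monotone (dcnt s) := by
  apply monotone_nat_of_le_succ
  intro i
  unfold dcnt
  rw [Finset.sum_range_succ]
  split_ifs <;> simp

theorem lex_iff {N : ℕ} {α : Type*} [LinearOrder α] (s : Fin N → α) (hs : Function.Injective s)
    (F : Fin N → ℤ) :
    (∀ i j, i < j → F i < F j ∨ F i = F j ∧ s i < s j) ↔
      Monotone (fun i : Fin N => F i - dcnt s i) := by
  have h1 : (∀ i j, i < j → F i < F j ∨ F i = F j ∧ s i < s j) ↔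
      StrictMono (fun i => toLex (F i, s i)) := by
    unfold StrictMono
    simp only [Prod.Lex.toLex_lt_toLex]
  rw [h1]
  rcases N with _ | k
  · constructor
    · intro _ i; exact i.elim0
    · intro _ i; exact i.elim0
  rw [Fin.strictMono_iff_lt_succ, Fin.monotone_iff_le_succ]
  apply forall_congr'
  intro i
  rw [Prod.Lex.toLex_lt_toLex]
  have hne : s i.castSucc ≠ s i.succ := fun h => by
    have := hs h
    simp [Fin.ext_iff] at this
  have hd : dcnt s (i.succ : ℕ) = dcnt s (i.castSucc : ℕ) +
      if s i.succ < s i.castSucc then 1 else 0 := by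
    simp only [dcnt, Fin.val_succ, Fin.val_castSucc, Finset.sum_range_succ]
    congr 1
    have : (∃ h : (i:ℕ) + 1 < k + 1, s ⟨i+1, h⟩ < s ⟨i, by omega⟩) ↔ s i.succ < s i.castSucc := by
      constructor
      · rintro ⟨h, h'⟩; exact h'
      · intro h; exact ⟨by omega, h⟩
    simp only [this]
  rw [hd]
  dsimp only
  split_ifs with h
  · have : ¬ s i.castSucc < s i.succ := not_lt.2 h.le
    simp only [this, and_false, or_false]
    omega
  · have : s i.castSucc < s i.succ := lt_of_le_of_ne (not_lt.1 h) hne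
    simp only [this, and_true]
    omega

theorem mono_of_shift {N : ℕ} {α : Type*} [LinearOrder α] (s : Fin N → α)
    (F : Fin N → ℤ) (h : Monotone (fun i : Fin N => F i - dcnt s i)) : Monotone F := by
  intro i j hij
  have h1 := h hij
  have h2 := dcnt_mono s (show (i:ℕ) ≤ j from hij)
  dsimp only at h1
  omega

theorem dcnt_dual {N : ℕ} {α : Type*} [LinearOrder α] (s : Fin N → α) (hs : Function.Injective s)
    (i : ℕ) (hi : i ≤ N - 1) : dcnt (fun x => OrderDual.toDual (s x)) i = i - dcnt s i := by
  induction i with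
  | zero => simp [dcnt]
  | succ i ih =>
    have ih := ih (by omega)
    unfold dcnt at ih ⊢
    rw [Finset.sum_range_succ, Finset.sum_range_succ, ih]
    have hN : i + 1 < N := by omega
    have hne : s ⟨i, by omega⟩ ≠ s ⟨i+1, hN⟩ := fun h => by
      have := hs h
      simp [Fin.ext_iff] at this
    have hl := lt_or_gt_of_ne hne
    simp only [hN, exists_true_left, OrderDual.toDual_lt_toDual]
    rcases hl with h | h
    · simp [h, not_lt.2 h.le]
      ring
    · simp [h, not_lt.2 h.le]

/-- functions with values in `[0,m)` -/
noncomputable def box (N : ℕ) (m : ℤ) : Finset (Fin N → ℤ) :=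
  Fintype.piFinset (fun _ => Finset.Ico 0 m)

theorem mem_box {N : ℕ} {m : ℤ} {f : Fin N → ℤ} : f ∈ box N m ↔ ∀ i, 0 ≤ f i ∧ f i < m := by
  simp [box]

noncomputable def Mcnt (N : ℕ) (m : ℤ) : ℕ := ((box N m).filter (fun g => Monotone g)).card

theorem Mcnt_nonpos {N : ℕ} (hN : 0 < N) {m : ℤ} (hm : m ≤ 0) : Mcnt N m = 0 := by
  unfold Mcnt
  rw [Finset.card_eq_zero, Finset.filter_eq_empty_iff]
  intro f hf
  have := mem_box.1 hf ⟨0, hN⟩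
  omega

theorem Mcnt_one {N : ℕ} : Mcnt N 1 = 1 := by
  unfold Mcnt
  rw [Finset.card_eq_one]
  refine ⟨fun _ => 0, ?_⟩
  ext f
  simp only [Finset.mem_filter, mem_box, Finset.mem_singleton]
  constructor
  · rintro ⟨h, -⟩
    funext i
    have := h i
    omega
  · rintro rfl
    exact ⟨fun i => by simp, monotone_const⟩

theorem sort_eq_iff {N : ℕ} (f : Fin N → ℤ) (e : Equiv.Perm (Fin N)) :
    Tuple.sort f = e ↔ Monotone (fun i : Fin N => f (e i) - dcnt e i) := by
  rw [← lex_iff e e.injective (fun i => f (e i)), eq_comm, Tuple.eq_sort_iff]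
  constructor
  · rintro ⟨h1, h2⟩ i j hij
    rcases lt_or_eq_of_le (h1 hij.le) with h | h
    · left; exact h
    · right; exact ⟨h, h2 i j hij h⟩
  · intro h
    constructor
    · intro i j hij
      rcases lt_or_eq_of_le hij with h' | rfl
      · rcases h i j h' with h | h
        · exact h.le
        · exact h.1.le
      · exact le_rfl
    · intro i j hij he
      rcases h i j hij with h | h
      · exact absurd he h.ne
      · exact h.2

theorem card_sort_eq {N : ℕ} (m : ℤ) (e : Equiv.Perm (Fin N)) :
    ((box N m).filter (fun f => Tuple.sort f = e)).card = Mcnt N (m - dcnt e (N-1)) := by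
  unfold Mcnt
  refine Finset.card_nbij' (fun f i => f (e i) - dcnt e i)
    (fun g x => g (e.symm x) + dcnt e (e.symm x)) ?_ ?_ ?_ ?_
  · intro f hf
    simp only [Finset.coe_filter, mem_box, Set.mem_ofPred_eq, sort_eq_iff] at hf ⊢
    refine ⟨fun i => ?_, hf.2⟩
    have hi := i.2
    have h0 := hf.2 (show (⟨0, by omega⟩ : Fin N) ≤ i from Nat.zero_le _)
    have h1 := hf.2 (show i ≤ (⟨N-1, by omega⟩ : Fin N) from by
      rw [Fin.le_def]; dsimp only; omega)
    have h2 := (hf.1 (e ⟨0, by omega⟩)).1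
    have h3 := (hf.1 (e ⟨N-1, by omega⟩)).2
    simp only [dcnt_zero] at h0 h1
    constructor <;> omega
  · intro g hg
    simp only [Finset.coe_filter, mem_box, Set.mem_ofPred_eq, sort_eq_iff] at hg ⊢
    refine ⟨fun x => ?_, ?_⟩
    · have h1 := hg.1 (e.symm x)
      have hi := (e.symm x).2
      have h2 := dcnt_mono e (show ((e.symm x : Fin N) : ℕ) ≤ N - 1 by omega)
      have h3 := dcnt_mono e (show 0 ≤ ((e.symm x : Fin N) : ℕ) by omega)
      rw [dcnt_zero] at h3
      constructor <;> omega
    · simpa using hg.2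
  · intro f _
    simp
  · intro g _
    simp

theorem card_sort_mem {N : ℕ} (m : ℤ) (L : Finset (Equiv.Perm (Fin N))) :
    ((box N m).filter (fun f => Tuple.sort f ∈ L)).card
      = ∑ e ∈ L, Mcnt N (m - dcnt e (N-1)) := by
  rw [Finset.card_eq_sum_card_fiberwise (f := fun f => Tuple.sort f) (t := L)]
  · apply Finset.sum_congr rfl
    intro e he
    rw [← card_sort_eq]
    congr 1
    ext f
    simp only [Finset.mem_filter]
    constructor
    · rintro ⟨⟨h1, h2⟩, h3⟩; exact ⟨h1, h3⟩
    · rintro ⟨h1, rfl⟩; exact ⟨⟨h1, he⟩, rfl⟩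
  · intro f hf
    simp at hf
    exact hf.2

theorem sum_fib {α : Type*} (L : Finset α) (u : α → ℤ) (M : ℤ → ℕ) (hM : ∀ m ≤ 0, M m = 0)
    (lo : ℤ) (hlo : ∀ x ∈ L, lo ≤ u x) (j : ℕ) :
    ∑ x ∈ L, M (lo + j - u x)
      = ∑ k ∈ Finset.range j, (L.filter (fun x => u x = lo + k)).card * M (j - k) := by
  have h1 : ∑ x ∈ L, M (lo + j - u x) = ∑ x ∈ L.filter (fun x => u x < lo + j), M (lo + j - u x) := by
    rw [Finset.sum_filter]
    apply Finset.sum_congr rfl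
    intro x _
    split_ifs with h
    · rfl
    · apply hM; omega
  rw [h1, ← Finset.sum_fiberwise_of_maps_to (t := Finset.range j) (g := fun x => (u x - lo).toNat)]
  · apply Finset.sum_congr rfl
    intro k hk
    rw [Finset.mem_range] at hk
    rw [← smul_eq_mul, ← Finset.sum_const]
    apply Finset.sum_congr
    · ext x
      simp only [Finset.mem_filter]
      constructor
      · rintro ⟨⟨h1, h2⟩, h3⟩
        have := hlo x h1
        exact ⟨h1, by omega⟩
      · rintro ⟨h1, h2⟩
        exact ⟨⟨h1, by omega⟩, by omega⟩
    · intro x hx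
      rw [Finset.mem_filter] at hx
      congr 1
      omega
  · intro x hx
    rw [Finset.mem_filter] at hx
    have := hlo x hx.1
    rw [Finset.mem_range]
    omega

theorem fib_eq {α β : Type*} (L : Finset α) (L' : Finset β) (u : α → ℤ) (u' : β → ℤ)
    (M : ℤ → ℕ) (hM : ∀ m ≤ 0, M m = 0) (hM1 : M 1 = 1)
    (h : ∀ m : ℤ, ∑ x ∈ L, M (m - u x) = ∑ x ∈ L', M (m - u' x)) (k : ℤ) :
    (L.filter (fun x => u x = k)).card = (L'.filter (fun x => u' x = k)).card := by
  obtain ⟨lo, h1, h2, h3⟩ : ∃ lo : ℤ, (∀ x ∈ L, lo ≤ u x) ∧ (∀ x ∈ L', lo ≤ u' x) ∧ lo ≤ k := by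
    obtain ⟨a, ha⟩ := (L.image u).bddBelow
    obtain ⟨b, hb⟩ := (L'.image u').bddBelow
    refine ⟨min (min a b) k, ?_, ?_, ?_⟩
    · intro x hx
      have : a ≤ u x := ha (by simpa using ⟨x, hx, rfl⟩)
      omega
    · intro x hx
      have : b ≤ u' x := hb (by simpa using ⟨x, hx, rfl⟩)
      omega
    · omega
  have key : ∀ j : ℕ, (L.filter (fun x => u x = lo + j)).card
      = (L'.filter (fun x => u' x = lo + j)).card := by
    intro j
    induction j using Nat.strong_induction_on with
    | _ j ih =>
      have h4 := h (lo + (j + 1 : ℕ))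
      rw [sum_fib L u M hM lo h1, sum_fib L' u' M hM lo h2, Finset.sum_range_succ,
        Finset.sum_range_succ] at h4
      have h5 : ∑ k ∈ Finset.range j, (L.filter (fun x => u x = lo + k)).card * M ((j + 1 : ℕ) - k)
          = ∑ k ∈ Finset.range j, (L'.filter (fun x => u' x = lo + k)).card * M ((j + 1 : ℕ) - k) := by
        apply Finset.sum_congr rfl
        intro k hk
        rw [ih k (Finset.mem_range.1 hk)]
      rw [h5] at h4
      have h6 : (((j + 1 : ℕ) : ℤ) - j) = 1 := by push_cast; ring
      rw [h6, hM1] at h4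
      omega
  have := key (k - lo).toNat
  have e : lo + ((k - lo).toNat : ℤ) = k := by omega
  rwa [e] at this

theorem sort_symm_lt {N : ℕ} (f : Fin N → ℤ) (x y : Fin N) :
    (Tuple.sort f).symm x < (Tuple.sort f).symm y ↔ f x < f y ∨ f x = f y ∧ x < y := by
  obtain ⟨h1, h2⟩ := Tuple.eq_sort_iff.1 (rfl : Tuple.sort f = Tuple.sort f)
  have key : ∀ x y, (Tuple.sort f).symm x < (Tuple.sort f).symm y →
      f x < f y ∨ f x = f y ∧ x < y := by
    intro x y h
    have h3 := h1 h.le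
    have h4 := h2 _ _ h
    simp only [Function.comp, Equiv.apply_symm_apply] at h3 h4
    rcases lt_or_eq_of_le h3 with h5 | h5
    · exact Or.inl h5
    · exact Or.inr ⟨h5, h4 h5⟩
  refine ⟨key x y, fun h => ?_⟩
  rcases lt_trichotomy ((Tuple.sort f).symm x) ((Tuple.sort f).symm y) with h3 | h3 | h3
  · exact h3
  · have : x = y := (Tuple.sort f).symm.injective h3
    subst this
    simp at h
  · exfalso
    rcases h with h | h <;> rcases key y x h3 with h' | h'
    · omega
    · omega
    · omega
    · exact absurd h.2 (not_lt.2 h'.2.le)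

def lo {n : ℕ} (v : Fin n) : Fin (2 * n) := ⟨2 * v, by omega⟩
def hi {n : ℕ} (v : Fin n) : Fin (2 * n) := ⟨2 * v + 1, by omega⟩

theorem lo_or_hi {n : ℕ} (x : Fin (2 * n)) : ∃ v : Fin n, x = lo v ∨ x = hi v := by
  refine ⟨⟨x / 2, by omega⟩, ?_⟩
  simp only [lo, hi, Fin.ext_iff]
  omega

/-- linear extensions of the poset `2 × n` labelled via `s` -/
def LL {n : ℕ} (s : Equiv.Perm (Fin n)) (e : Equiv.Perm (Fin (2 * n))) : Prop :=
  (∀ v, e.symm (lo v) < e.symm (hi v)) ∧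
  (∀ i j, i < j → e.symm (hi (s i)) < e.symm (hi (s j))) ∧
  (∀ i j, i < j → e.symm (lo (s i)) < e.symm (lo (s j)))

theorem LL_sort {n : ℕ} (s : Equiv.Perm (Fin n)) (f : Fin (2 * n) → ℤ) :
    LL s (Tuple.sort f) ↔ (∀ i, f (lo (s i)) ≤ f (hi (s i))) ∧
      Monotone (fun i : Fin n => f (hi (s i)) - dcnt s i) ∧
      Monotone (fun i : Fin n => f (lo (s i)) - dcnt s i) := by
  unfold LL
  rw [← lex_iff s s.injective (fun i => f (hi (s i))), ← lex_iff s s.injective (fun i => f (lo (s i)))]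
  simp only [sort_symm_lt]
  refine and_congr ?_ (and_congr ?_ ?_)
  · rw [s.surjective.forall]
    apply forall_congr'
    intro v
    have : lo (s v) < hi (s v) := by simp [lo, hi]
    simp only [this, and_true]
    omega
  · simp [hi]
  · simp [lo]

theorem LL_sort_rev {n : ℕ} (s : Equiv.Perm (Fin n)) (f : Fin (2 * n) → ℤ) :
    LL s ((Tuple.sort f).trans Fin.revPerm) ↔
      (∀ i, f (Fin.rev (lo (s i))) < f (Fin.rev (hi (s i)))) ∧
      Monotone (fun i : Fin n => f (Fin.rev (hi (s i))) - (i - dcnt s i)) ∧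
      Monotone (fun i : Fin n => f (Fin.rev (lo (s i))) - (i - dcnt s i)) := by
  unfold LL
  have hd : ∀ i : Fin n, (i : ℤ) - dcnt s i = dcnt (fun x => OrderDual.toDual (s x)) i := fun i =>
    (dcnt_dual s s.injective i (by omega)).symm
  simp only [hd]
  have hinj : Function.Injective (fun x => OrderDual.toDual (s x)) := fun a b h => by simpa using h
  rw [← lex_iff _ hinj (fun i => f (Fin.rev (hi (s i)))),
    ← lex_iff _ hinj (fun i => f (Fin.rev (lo (s i))))]
  simp only [Equiv.symm_trans_apply, Fin.revPerm_symm, Fin.revPerm_apply, sort_symm_lt]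
  refine and_congr ?_ (and_congr ?_ ?_)
  · rw [s.surjective.forall]
    apply forall_congr'
    intro v
    have : ¬ Fin.rev (lo (s v)) < Fin.rev (hi (s v)) := by simp [lo, hi, Fin.rev_lt_rev, Fin.le_def]
    simp only [this, and_false, or_false]
  · simp [hi, Fin.rev_lt_rev]
  · simp [lo, Fin.rev_lt_rev]

/-- shift function -/
noncomputable def delta {n : ℕ} (s : Equiv.Perm (Fin n)) (x : Fin (2 * n)) : ℤ :=
  ((s.symm ⟨x / 2, by omega⟩ : Fin n) : ℤ) - 2 * dcnt s (s.symm ⟨x / 2, by omega⟩ : Fin n) +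
    ((x % 2 : ℕ) : ℤ)

theorem delta_lo {n : ℕ} (s : Equiv.Perm (Fin n)) (i : Fin n) :
    delta s (lo (s i)) = i - 2 * dcnt s i := by
  have : (⟨(lo (s i) : ℕ) / 2, by omega⟩ : Fin n) = s i := by
    simp [lo]
  unfold delta
  rw [this]
  simp [lo]

theorem delta_hi {n : ℕ} (s : Equiv.Perm (Fin n)) (i : Fin n) :
    delta s (hi (s i)) = i - 2 * dcnt s i + 1 := by
  have : (⟨(hi (s i) : ℕ) / 2, by omega⟩ : Fin n) = s i := by
    simp only [hi, Fin.ext_iff]; omega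
  unfold delta
  rw [this]
  simp only [hi, Equiv.symm_apply_apply]
  have : (2 * (s i : ℕ) + 1) % 2 = 1 := by omega
  rw [this]; simp

theorem bnd_iff {n : ℕ} (hn : 0 < n) (s : Equiv.Perm (Fin n)) (f : Fin (2 * n) → ℤ)
    (h0 : ∀ i, f (lo (s i)) ≤ f (hi (s i))) (h1 : Monotone (fun i : Fin n => f (hi (s i))))
    (h2 : Monotone (fun i : Fin n => f (lo (s i)))) (m : ℤ) :
    (∀ x, 0 ≤ f x ∧ f x < m) ↔ 0 ≤ f (lo (s ⟨0, hn⟩)) ∧ f (hi (s ⟨n-1, by omega⟩)) < m := by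
  constructor
  · intro h; exact ⟨(h _).1, (h _).2⟩
  · rintro ⟨ha, hb⟩ x
    obtain ⟨v, hv⟩ := lo_or_hi x
    obtain ⟨i, rfl⟩ := s.surjective v
    have a1 := h2 (show (⟨0, hn⟩ : Fin n) ≤ i from Nat.zero_le _)
    have a2 := h1 (show i ≤ (⟨n-1, by omega⟩ : Fin n) from by rw [Fin.le_def]; dsimp only; omega)
    have a3 := h0 i
    dsimp only at a1 a2
    rcases hv with rfl | rfl <;> omega

theorem card_shift {n : ℕ} (hn : 0 < n) (s : Equiv.Perm (Fin n)) (m : ℤ) :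
    ((box (2 * n) m).filter (fun f => LL s (Tuple.sort f))).card =
    ((box (2 * n) (m + n - 2 * dcnt s (n-1))).filter
      (fun f => LL s ((Tuple.sort f).trans Fin.revPerm))).card := by
  have main : ∀ f : Fin (2 * n) → ℤ,
      (f ∈ box (2 * n) m ∧ LL s (Tuple.sort f)) ↔
      ((fun x => f (Fin.rev x) + delta s (Fin.rev x)) ∈ box (2 * n) (m + n - 2 * dcnt s (n-1)) ∧
        LL s ((Tuple.sort (fun x => f (Fin.rev x) + delta s (Fin.rev x))).trans Fin.revPerm)) := by
    intro f
    have hL : LL s (Tuple.sort f) ↔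
        LL s ((Tuple.sort (fun x => f (Fin.rev x) + delta s (Fin.rev x))).trans Fin.revPerm) := by
      rw [LL_sort, LL_sort_rev]
      simp only [Fin.rev_rev, delta_lo, delta_hi]
      refine and_congr ?_ (and_congr ?_ ?_)
      · apply forall_congr'; intro i; omega
      · unfold Monotone
        refine forall_congr' fun i => forall_congr' fun j => forall_congr' fun _ => ?_
        dsimp only
        omega
      · unfold Monotone
        refine forall_congr' fun i => forall_congr' fun j => forall_congr' fun _ => ?_
        dsimp only
        omega
    rw [← hL]
    apply and_congr_left
    intro h
    have h' := hL.1 h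
    rw [LL_sort] at h
    rw [LL_sort_rev] at h'
    rw [mem_box, mem_box, bnd_iff hn s f h.1 (mono_of_shift _ _ h.2.1) (mono_of_shift _ _ h.2.2)]
    simp only [Fin.rev_rev] at h'
    have hd : ∀ i : Fin n, (i : ℤ) - dcnt s i = dcnt (fun x => OrderDual.toDual (s x)) i := fun i =>
      (dcnt_dual s s.injective i (by omega)).symm
    simp only [hd] at h'
    have := bnd_iff hn s (fun x => f x + delta s x) (fun i => (h'.1 i).le)
      (mono_of_shift _ _ h'.2.1) (mono_of_shift _ _ h'.2.2) (m + n - 2 * dcnt s (n-1))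
    rw [Fin.rev_surjective.forall]
    simp only [Fin.rev_rev]
    rw [this]
    simp only [delta_lo, delta_hi, dcnt_zero]
    push_cast [Nat.cast_sub hn]
    omega
  refine Finset.card_nbij' (fun f x => f (Fin.rev x) + delta s (Fin.rev x))
    (fun g x => g (Fin.rev x) - delta s x) ?_ ?_ ?_ ?_
  · intro f hf
    rw [Finset.mem_coe, Finset.mem_filter] at hf ⊢
    exact (main f).1 hf
  · intro g hg
    rw [Finset.mem_coe, Finset.mem_filter] at hg ⊢
    rw [main]
    simpa using hg
  · intro f _
    simp
  · intro g _
    simp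

theorem des_rev {N : ℕ} (hN : 0 < N) (e : Equiv.Perm (Fin N)) :
    dcnt (e.trans Fin.revPerm) (N - 1) = N - 1 - dcnt e (N - 1) := by
  have := dcnt_dual e e.injective (N - 1) le_rfl
  push_cast [Nat.cast_sub hN] at this
  rw [← this]
  unfold dcnt
  simp [Fin.rev_lt_rev]

theorem perm_sym {n : ℕ} (hn : 0 < n) (s : Equiv.Perm (Fin n)) (k : ℤ) :
    ((Finset.univ : Finset (Equiv.Perm (Fin (2 * n)))).filter
      (fun e => LL s e ∧ dcnt e (2 * n - 1) = dcnt s (n-1) + k)).card =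
    ((Finset.univ : Finset (Equiv.Perm (Fin (2 * n)))).filter
      (fun e => LL s e ∧ dcnt e (2 * n - 1) = dcnt s (n-1) + (n - 1 - k))).card := by
  have h2 : 0 < 2 * n := by omega
  have h := fib_eq (Finset.univ.filter (fun e => LL s e))
    (Finset.univ.filter (fun e : Equiv.Perm (Fin (2 * n)) => LL s (e.trans Fin.revPerm)))
    (fun e => dcnt e (2 * n - 1))
    (fun e => dcnt e (2 * n - 1) - n + 2 * dcnt s (n-1)) (Mcnt (2 * n))
    (fun m hm => Mcnt_nonpos h2 hm) Mcnt_one (by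
      intro m
      rw [← card_sort_mem]
      have := card_shift hn s m
      simp only [Finset.mem_filter, Finset.mem_univ, true_and]
      rw [this]
      have h3 := card_sort_mem (m + n - 2 * dcnt s (n-1))
        (Finset.univ.filter (fun e : Equiv.Perm (Fin (2 * n)) => LL s (e.trans Fin.revPerm)))
      simp only [Finset.mem_filter, Finset.mem_univ, true_and] at h3
      rw [h3]
      apply Finset.sum_congr rfl
      intro e _
      congr 1
      ring) (dcnt s (n-1) + k)
  rw [Finset.filter_filter, Finset.filter_filter] at h
  rw [h]
  refine Finset.card_nbij' (fun e => e.trans Fin.revPerm) (fun e => e.trans Fin.revPerm) ?_ ?_ ?_ ?_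
  · intro e he
    simp only [Finset.mem_coe, Finset.mem_filter, Finset.mem_univ, true_and] at he ⊢
    refine ⟨he.1, ?_⟩
    rw [des_rev h2]
    push_cast
    omega
  · intro e he
    simp only [Finset.mem_coe, Finset.mem_filter, Finset.mem_univ, true_and] at he ⊢
    refine ⟨?_, ?_⟩
    · convert he.1 using 1
      ext x; simp
    · rw [des_rev h2]
      push_cast
      omega
  · intro e _
    ext x; simp
  · intro e _
    ext x; simp

def hh {n : ℕ} (x : Fin (2 * n)) : ℕ := x / 2 + 1

theorem ofFn_range (N : ℕ) (F : ℕ → ℕ) : List.ofFn (fun i : Fin N => F i) = (List.range N).map F := by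
  apply List.ext_getElem <;> simp

theorem baseWord_two (n : ℕ) : baseWord n 2 = List.ofFn (hh (n := n)) := by
  have : List.ofFn (hh (n := n)) = (List.range (2 * n)).map (fun x => x / 2 + 1) :=
    ofFn_range (2 * n) (fun x => x / 2 + 1)
  rw [this]
  unfold baseWord
  induction n with
  | zero => simp
  | succ n ih =>
    rw [List.range_succ, List.flatMap_append, ih (ofFn_range (2 * n) (fun x => x / 2 + 1)), show 2 * (n + 1) = 2 * n + 1 + 1 by ring,
      List.range_succ, List.range_succ]
    simp
    omega

theorem baseWord_one (n : ℕ) : baseWord n 1 = List.ofFn (fun i : Fin n => (i : ℕ) + 1) := by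
  rw [ofFn_range n (fun x => x + 1)]
  unfold baseWord
  induction n with
  | zero => simp
  | succ n ih => simp only [List.range_succ, List.flatMap_append, ih, List.map_append]; simp

theorem exists_perm {N : ℕ} (l : List ℕ) (h : Fin N → ℕ) (hm : Monotone h)
    (hl : l.Perm (List.ofFn h)) : ∃ e : Equiv.Perm (Fin N), l = List.ofFn (fun i => h (e i)) ∧
      ∀ i j, i < j → h i = h j → e.symm i < e.symm j := by
  have hlen : l.length = N := by simpa using hl.length_eq
  obtain ⟨g, rfl⟩ : ∃ g : Fin N → ℕ, l = List.ofFn g := by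
    subst hlen
    exact ⟨l.get, (List.ofFn_get l).symm⟩
  have h1 : List.ofFn (g ∘ Tuple.sort g) = List.ofFn h :=
    (((Tuple.sort g).ofFn_comp_perm g).trans hl).eq_of_pairwise'
      (Tuple.monotone_sort g).sortedLE_ofFn.pairwise hm.sortedLE_ofFn.pairwise
  have h2 : g ∘ Tuple.sort g = h := List.ofFn_injective h1
  obtain ⟨_, h4⟩ := Tuple.eq_sort_iff.1 (rfl : Tuple.sort g = Tuple.sort g)
  refine ⟨(Tuple.sort g).symm, ?_, ?_⟩
  · congr 1
    funext i
    rw [← h2]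
    simp
  · intro i j hij he
    rw [← h2] at he
    simpa using h4 i j hij he

theorem hh_mono {n : ℕ} : Monotone (hh (n := n)) := by
  intro i j hij
  have : (i : ℕ) ≤ j := hij
  unfold hh
  omega

theorem perm_unique {n : ℕ} (e e' : Equiv.Perm (Fin (2 * n)))
    (h : ∀ v, e.symm (lo v) < e.symm (hi v)) (h' : ∀ v, e'.symm (lo v) < e'.symm (hi v))
    (heq : (fun i => hh (e i)) = (fun i => hh (e' i))) : e = e' := by
  have key : ∀ e : Equiv.Perm (Fin (2 * n)), (∀ v, e.symm (lo v) < e.symm (hi v)) →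
      e.symm = Tuple.sort (fun i => hh (e i)) := by
    intro e he
    rw [Tuple.eq_sort_iff]
    constructor
    · intro i j hij
      simpa using hh_mono hij
    · intro i j hij hij'
      simp only [Equiv.apply_symm_apply] at hij'
      have h1 := he ⟨i / 2, by omega⟩
      have hij : (i : ℕ) < j := hij
      unfold hh at hij'
      have h2 : lo ⟨(i : ℕ) / 2, by omega⟩ = i := by
        simp only [lo, Fin.ext_iff]; omega
      have h3 : hi ⟨(i : ℕ) / 2, by omega⟩ = j := by
        simp only [hi, Fin.ext_iff]; omega
      rwa [h2, h3] at h1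
  have h1 := key e h
  have h2 := key e' h'
  rw [heq, ← h2] at h1
  exact Equiv.symm_bijective.injective h1

theorem des_list (l : List ℕ) : (des l : ℤ) =
    ∑ j ∈ Finset.range (l.length - 1), if l.getD (j+1) 0 < l.getD j 0 then 1 else 0 := by
  induction l with
  | nil => simp [des]
  | cons a t ih =>
    cases t with
    | nil => simp [des]
    | cons b t =>
      have h1 : (des (a :: b :: t) : ℤ) = des (b :: t) + if b < a then 1 else 0 := by
        unfold des
        by_cases h : b < a <;> simp [h]
      rw [h1, ih]
      simp only [List.length_cons, Nat.add_sub_cancel]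
      rw [Finset.sum_range_succ']
      simp

theorem des_ofFn {N : ℕ} (g : Fin N → ℕ) : (des (List.ofFn g) : ℤ) = dcnt g (N - 1) := by
  rw [des_list]
  unfold dcnt
  simp only [List.length_ofFn]
  apply Finset.sum_congr rfl
  intro j hj
  rw [Finset.mem_range] at hj
  have h1 : j + 1 < N := by omega
  have h2 : j < N := by omega
  simp [List.getD_eq_getElem?_getD, List.getElem?_ofFn, h1, h2]

theorem dcnt_congr {N : ℕ} {α β : Type*} [LinearOrder α] [LinearOrder β] (s : Fin N → α)
    (t : Fin N → β) (k : ℕ)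
    (h : ∀ (j : ℕ) (hj : j + 1 < N), s ⟨j+1, hj⟩ < s ⟨j, by omega⟩ ↔ t ⟨j+1, hj⟩ < t ⟨j, by omega⟩) :
    dcnt s k = dcnt t k := by
  unfold dcnt
  apply Finset.sum_congr rfl
  intro j _
  have : (∃ h : j + 1 < N, s ⟨j+1, h⟩ < s ⟨j, by omega⟩) ↔
      (∃ h : j + 1 < N, t ⟨j+1, h⟩ < t ⟨j, by omega⟩) := exists_congr (fun hj => h j hj)
  simp only [this]

theorem des_word {n : ℕ} (e : Equiv.Perm (Fin (2 * n)))
    (h : ∀ v, e.symm (lo v) < e.symm (hi v)) :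
    (des (List.ofFn (fun i => hh (e i))) : ℤ) = dcnt e (2 * n - 1) := by
  rw [des_ofFn]
  apply dcnt_congr
  intro j hj
  constructor
  · intro h1
    by_contra h2
    exact absurd h1 (not_lt.2 (hh_mono (not_lt.1 h2)))
  · intro h1
    by_contra h2
    generalize hx : e ⟨j, by omega⟩ = x at *
    generalize hy : e ⟨j+1, hj⟩ = y at *
    have h1' : (y : ℕ) < x := h1
    unfold hh at h2
    have h3 : lo ⟨(y : ℕ) / 2, by omega⟩ = y := by
      simp only [lo, Fin.ext_iff]; omega
    have h4 : hi ⟨(y : ℕ) / 2, by omega⟩ = x := by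
      simp only [hi, Fin.ext_iff]; omega
    have h5 := h ⟨(y : ℕ) / 2, by omega⟩
    rw [h3, h4, ← hx, ← hy] at h5
    simp at h5

theorem dedup_filter {α β : Type*} [DecidableEq β] (h : α → β) (P : α → Bool) (l : List α)
    (H1 : l.Pairwise (fun x y => P x = true → h x ≠ h y))
    (H2 : ∀ x t, (x :: t) <:+ l → P x = false → h x ∈ t.map h) :
    (l.map h).dedup = (l.filter P).map h := by
  induction l with
  | nil => simp
  | cons a t ih =>
    have ih := ih H1.of_cons (fun x u hu => H2 x u (hu.trans (List.suffix_cons a t)))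
    rw [List.map_cons, List.filter_cons]
    cases hP : P a with
    | false =>
      rw [List.dedup_cons_of_mem (H2 a t (List.suffix_refl _) hP), ih]
      simp
    | true =>
      rw [List.dedup_cons_of_notMem, ih]
      · simp
      · intro hm
        rw [List.mem_map] at hm
        obtain ⟨y, hy, hy'⟩ := hm
        exact (List.pairwise_cons.1 H1).1 y hy hP hy'.symm

theorem dedup_word {n : ℕ} [DecidableEq ℕ] (s : Equiv.Perm (Fin n)) (e : Equiv.Perm (Fin (2 * n)))
    (h : ∀ v, e.symm (lo v) < e.symm (hi v)) :
    (List.ofFn (fun i => hh (e i))).dedup = List.ofFn (fun i => (s i : ℕ) + 1) ↔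
      ∀ i j, i < j → e.symm (hi (s i)) < e.symm (hi (s j)) := by
  have hpw : (List.ofFn e).Pairwise (fun x y => e.symm x < e.symm y) := by
    rw [List.pairwise_ofFn]
    intro i j hij
    simpa using hij
  have hmem : ∀ x, x ∈ List.ofFn e := by
    intro x
    rw [List.mem_ofFn]
    exact e.surjective x
  have h1 : List.ofFn (fun i => hh (e i)) = (List.ofFn e).map hh := by
    rw [List.map_ofFn]; rfl
  have h2 : List.ofFn (fun i => (s i : ℕ) + 1) = (List.ofFn (fun i => hi (s i))).map hh := by
    rw [List.map_ofFn]
    congr 1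
    funext i
    simp only [Function.comp, hi, hh]
    omega
  let P : Fin (2 * n) → Bool := fun x => decide ((x : ℕ) % 2 = 1)
  rw [h1, h2, dedup_filter hh P]
  · have hinj : ((List.ofFn e).filter P).map hh = (List.ofFn (fun i => hi (s i))).map hh ↔
        (List.ofFn e).filter P = List.ofFn (fun i => hi (s i)) := by
      constructor
      · intro hEq
        have := congrArg (List.map (fun k => 2 * (k - 1) + 1)) hEq
        rw [List.map_map, List.map_map] at this
        have e1 : ((List.ofFn e).filter P).map ((fun k => 2 * (k - 1) + 1) ∘ hh)
            = ((List.ofFn e).filter P).map Fin.val := by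
          apply List.map_congr_left
          intro x hx
          have := (List.mem_filter.1 hx).2
          simp only [P, decide_eq_true_eq] at this
          simp only [Function.comp, hh]
          omega
        have e2 : (List.ofFn (fun i => hi (s i))).map ((fun k => 2 * (k - 1) + 1) ∘ hh)
            = (List.ofFn (fun i => hi (s i))).map Fin.val := by
          apply List.map_congr_left
          intro x hx
          rw [List.mem_ofFn] at hx
          obtain ⟨i, rfl⟩ := hx
          simp only [Function.comp, hh, hi]
          omega
        rw [e1, e2] at this
        exact List.map_injective_iff.2 Fin.val_injective this
      · intro h; rw [h]
    rw [hinj]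
    constructor
    · intro hEq
      have := hpw.sublist (List.filter_sublist (p := P))
      rw [hEq, List.pairwise_ofFn] at this
      intro i j hij
      exact this hij
    · intro hc
      apply List.Perm.eq_of_pairwise (le := fun x y => e.symm x < e.symm y)
      · intro a b _ _ hab hba
        exact absurd hab (not_lt.2 hba.le)
      · exact hpw.sublist List.filter_sublist
      · rw [List.pairwise_ofFn]
        intro i j hij
        exact hc i j hij
      · rw [List.perm_ext_iff_of_nodup]
        · intro x
          rw [List.mem_filter, List.mem_ofFn' (fun i => hi (s i))]
          simp only [Set.mem_range, hmem, true_and, P, decide_eq_true_eq]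
          constructor
          · intro hx
            refine ⟨s.symm ⟨x / 2, by omega⟩, ?_⟩
            simp only [Equiv.apply_symm_apply, hi, Fin.ext_iff]
            omega
          · rintro ⟨i, rfl⟩
            simp only [hi]
            omega
        · exact (List.nodup_ofFn.2 e.injective).filter _
        · rw [List.nodup_ofFn]
          intro i j hij
          simp only [hi, Fin.ext_iff] at hij
          exact s.injective (Fin.ext (by omega))
  · refine hpw.imp ?_
    intro x y hxy hP hEq
    simp only [P, decide_eq_true_eq] at hP
    simp only [hh] at hEq
    have hne : (x : ℕ) ≠ y := by
      intro hc
      have := Fin.ext hc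
      subst this
      simp at hxy
    have h3 : hi ⟨(x : ℕ) / 2, by omega⟩ = x := by
      simp only [hi, Fin.ext_iff]; omega
    have h4 : lo ⟨(x : ℕ) / 2, by omega⟩ = y := by
      simp only [lo, Fin.ext_iff]; omega
    have h5 := h ⟨(x : ℕ) / 2, by omega⟩
    rw [h3, h4] at h5
    exact absurd h5 (not_lt.2 hxy.le)
  · rintro x t ⟨p, hp⟩ hP
    simp only [P, decide_eq_false_iff_not] at hP
    rw [List.mem_map]
    have h4 : lo ⟨(x : ℕ) / 2, by omega⟩ = x := by
      simp only [lo, Fin.ext_iff]; omega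
    have h5 := h ⟨(x : ℕ) / 2, by omega⟩
    refine ⟨hi ⟨(x : ℕ) / 2, by omega⟩, ?_, by simp only [hi, hh]; omega⟩
    rw [h4] at h5
    have hm := hmem (hi ⟨(x : ℕ) / 2, by omega⟩)
    rw [← hp, List.mem_append, List.mem_cons] at hm
    rcases hm with hm | hm | hm
    · rw [← hp, List.pairwise_append] at hpw
      have := hpw.2.2 _ hm x (by simp)
      exact absurd h5 (not_lt.2 this.le)
    · rw [hm] at h5
      simp at h5
    · exact hm

theorem avoids_word {n : ℕ} (s : Equiv.Perm (Fin n)) (e : Equiv.Perm (Fin (2 * n)))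
    (h : ∀ v, e.symm (lo v) < e.symm (hi v))
    (h1 : ∀ i j, i < j → e.symm (hi (s i)) < e.symm (hi (s j))) :
    avoids (List.ofFn (fun i => hh (e i))) ↔
      ∀ i j, i < j → e.symm (lo (s i)) < e.symm (lo (s j)) := by
  have hget : ∀ i : Fin (2 * n), (List.ofFn (fun i => hh (e i))).getD i 0 = hh (e i) := by
    intro i
    simp [List.getD_eq_getElem?_getD, List.getElem?_ofFn]
  constructor
  · intro ha i j hij
    by_contra hc
    have hne : s i ≠ s j := fun hc => hij.ne (s.injective hc)
    have hne' : (s i : ℕ) ≠ s j := fun hc => hne (Fin.ext hc)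
    have hlt : e.symm (lo (s j)) < e.symm (lo (s i)) := by
      refine lt_of_le_of_ne (not_lt.1 hc) ?_
      intro hEq
      have := e.symm.injective hEq
      simp only [lo, Fin.ext_iff] at this
      omega
    have := ha _ _ _ _ (show (e.symm (lo (s j)) : ℕ) < e.symm (lo (s i)) from hlt)
      (show (e.symm (lo (s i)) : ℕ) < e.symm (hi (s i)) from h _)
      (show (e.symm (hi (s i)) : ℕ) < e.symm (hi (s j)) from h1 i j hij) (by simp)
    rw [hget, hget, hget, hget] at this
    simp only [Equiv.apply_symm_apply, hh, lo, hi] at this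
    omega
  · intro h2 i j k m hij hjk hkm hm him hjk'
    rw [List.length_ofFn] at hm
    have g1 := hget ⟨i, by omega⟩
    have g2 := hget ⟨j, by omega⟩
    have g3 := hget ⟨k, by omega⟩
    have g4 := hget ⟨m, by omega⟩
    dsimp only at g1 g2 g3 g4
    rw [g1, g4] at him
    rw [g2, g3] at hjk'
    rw [g1, g2]
    have pair : ∀ a b : Fin (2 * n), a < b → hh (e a) = hh (e b) →
        ∃ u : Fin n, e.symm (lo (s u)) = a ∧ e.symm (hi (s u)) = b := by
      intro a b hab hEq
      have hne : (e a : ℕ) ≠ e b := fun hc => hab.ne (e.injective (Fin.ext hc))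
      unfold hh at hEq
      refine ⟨s.symm ⟨(e a : ℕ) / 2, by omega⟩, ?_⟩
      rw [Equiv.apply_symm_apply]
      rcases Nat.lt_or_gt_of_ne hne with hl | hl
      · constructor
        · rw [Equiv.symm_apply_eq]; simp only [lo, Fin.ext_iff]; omega
        · rw [Equiv.symm_apply_eq]; simp only [hi, Fin.ext_iff]; omega
      · exfalso
        have h5 := h ⟨(e a : ℕ) / 2, by omega⟩
        have h3 : lo ⟨(e a : ℕ) / 2, by omega⟩ = e b := by
          simp only [lo, Fin.ext_iff]; omega
        have h4 : hi ⟨(e a : ℕ) / 2, by omega⟩ = e a := by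
          simp only [hi, Fin.ext_iff]; omega
        rw [h3, h4, Equiv.symm_apply_apply, Equiv.symm_apply_apply] at h5
        exact absurd h5 (not_lt.2 hab.le)
    obtain ⟨u, hu1, hu2⟩ := pair ⟨i, by omega⟩ ⟨m, by omega⟩ (by rw [Fin.lt_def]; dsimp only; omega) him
    obtain ⟨w, hw1, hw2⟩ := pair ⟨j, by omega⟩ ⟨k, by omega⟩ (by rw [Fin.lt_def]; dsimp only; omega) hjk'
    exfalso
    rcases lt_trichotomy u w with huw | huw | huw
    · have := h1 u w huw
      rw [hu2, hw2, Fin.lt_def] at this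
      dsimp only at this
      omega
    · subst huw
      rw [hu1, Fin.ext_iff] at hw1
      dsimp only at hw1
      omega
    · have := h2 w u huw
      rw [hu1, hw1, Fin.lt_def] at this
      dsimp only at this
      omega

theorem card_words {n : ℕ} (s : Equiv.Perm (Fin n)) (k : ℕ) :
    ((nonnest n).filter (fun π => π.dedup = List.ofFn (fun i => (s i : ℕ) + 1) ∧ des π = k)).card =
    ((Finset.univ : Finset (Equiv.Perm (Fin (2 * n)))).filter
      (fun e => LL s e ∧ dcnt e (2 * n - 1) = k)).card := by
  symm
  refine Finset.card_bij (fun e _ => List.ofFn (fun i => hh (e i))) ?_ ?_ ?_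
  · intro e he
    simp only [Finset.mem_filter, Finset.mem_univ, true_and] at he
    obtain ⟨⟨h0, h1, h2⟩, h3⟩ := he
    rw [← des_word e h0] at h3
    simp only [nonnest, multiPerms, Finset.mem_filter, List.mem_toFinset, List.mem_permutations]
    refine ⟨⟨?_, (avoids_word s e h0 h1).2 h2⟩, (dedup_word s e h0).2 h1, by exact_mod_cast h3⟩
    rw [baseWord_two]
    exact e.ofFn_comp_perm hh
  · intro e he e' he' hEq
    simp only [Finset.mem_filter, Finset.mem_univ, true_and] at he he'
    exact perm_unique e e' he.1.1 he'.1.1 (List.ofFn_injective hEq)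
  · intro l hl
    simp only [nonnest, multiPerms, Finset.mem_filter, List.mem_toFinset,
      List.mem_permutations] at hl
    obtain ⟨⟨hp, ha⟩, hd, hk⟩ := hl
    rw [baseWord_two] at hp
    obtain ⟨e, rfl, he⟩ := exists_perm l hh hh_mono hp
    have h0 : ∀ v, e.symm (lo v) < e.symm (hi v) := by
      intro v
      apply he
      · rw [Fin.lt_def]; simp only [lo, hi]; omega
      · simp only [lo, hi, hh]; omega
    have h1 := (dedup_word s e h0).1 hd
    have h2 := (avoids_word s e h0 h1).1 ha
    refine ⟨e, ?_, rfl⟩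
    simp only [Finset.mem_filter, Finset.mem_univ, true_and]
    refine ⟨⟨h0, h1, h2⟩, ?_⟩
    rw [← des_word e h0]
    exact_mod_cast hk

/-- For each σ ∈ S_n, the distribution of des(π) - des(σ) on nonnesting permutations
with first-copy subsequence σ is symmetric: the count with value r equals the count
with value n - 1 - r. -/
theorem des_symmetric_sigma (n : ℕ) (σ : List ℕ) (hσ : σ ∈ multiPerms n 1)
    (r : ℕ) (hr : r ≤ n - 1) :
    ((nonnest n).filter (fun π => π.dedup = σ ∧ des π = des σ + r)).card
      = ((nonnest n).filter (fun π => π.dedup = σ ∧ des π = des σ + (n - 1 - r))).card := by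
  rcases Nat.eq_zero_or_pos n with hn | hn
  · subst hn
    have : r = 0 := by omega
    subst this
    rfl
  simp only [multiPerms, List.mem_toFinset, List.mem_permutations] at hσ
  rw [baseWord_one] at hσ
  obtain ⟨s, hs, -⟩ := exists_perm σ (fun i : Fin n => (i : ℕ) + 1)
    (fun i j hij => Nat.succ_le_succ hij) hσ
  have hdes : (des σ : ℤ) = dcnt s (n - 1) := by
    rw [hs, des_ofFn]
    apply dcnt_congr
    intro j hj
    rw [Fin.lt_def]
    omega
  generalize hD : des σ = D at *
  rw [hs, card_words, card_words]
  have := perm_sym hn s r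
  push_cast [Nat.cast_sub hr, Nat.cast_sub hn] at this ⊢
  rw [hdes]
  exact this
end

section
/- The Lalanne–Kreweras involution LK on Dyck paths satisfies pea(D) = n + 1 - pea(LK(D)) for every D in D_n; in particular, the number of Dyck paths in D_n with r peaks equals the number with n + 1 - r peaks. -/
attribute [local instance] Classical.propDecidable

/-- Dyck words: E = true, N = false, n steps of each kind, every prefix staying
weakly below the diagonal. -/
noncomputable def dyckWords (n : ℕ) : Finset (List Bool) :=
  ((List.replicate n true ++ List.replicate n false).permutations.toFinset).filter
    (fun s => ∀ k, (s.take k).count false ≤ (s.take k).count true)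

/-- A peak is a consecutive EN pair. -/
def isPeak (s : List Bool) (i : ℕ) : Prop :=
  i + 1 < s.length ∧ s.getD i false = true ∧ s.getD (i+1) true = false

/-- A low peak is a peak touching the diagonal. -/
def isLowPeak (s : List Bool) (i : ℕ) : Prop :=
  isPeak s i ∧ (s.take (i+1)).count true = (s.take (i+1)).count false + 1

/-- Number of peaks. -/
noncomputable def pea (s : List Bool) : ℕ :=
  ((Finset.range s.length).filter (fun i => isPeak s i)).card
/-- Number of low peaks. -/
noncomputable def lpea (s : List Bool) : ℕ :=
  ((Finset.range s.length).filter (fun i => isLowPeak s i)).card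
/-- Number of high peaks. -/
noncomputable def hpea (s : List Bool) : ℕ :=
  ((Finset.range s.length).filter (fun i => isPeak s i ∧ ¬ isLowPeak s i)).card

/-- The corners (x,y) of the peaks EN of a Dyck word. -/
noncomputable def peakCorners (s : List Bool) : Finset (ℕ × ℕ) :=
  ((Finset.range s.length).filter (fun i => isPeak s i)).image
    (fun i => ((s.take (i+1)).count true, (s.take i).count false))

open BinaryTree in
/-- The word of a binary tree. -/
def lkWord : BinaryTree Unit → List Bool
  | nil => []
  | node _ l r => true :: (lkWord l ++ false :: lkWord r)

/-- Number of nodes with empty left child. -/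
noncomputable def lkPk : BinaryTree Unit → ℕ
  | .nil => 0
  | .node _ l r => lkPk l + lkPk r + if l = .nil then 1 else 0

/-- Mirror image. -/
def lkMirror : BinaryTree Unit → BinaryTree Unit
  | .nil => .nil
  | .node a l r => .node a (lkMirror r) (lkMirror l)

theorem lkMirror_mirror (t : BinaryTree Unit) : lkMirror (lkMirror t) = t := by
  induction t with
  | nil => rfl
  | node a l r hl hr => simp [lkMirror, hl, hr]

theorem lkMirror_eq_nil (t : BinaryTree Unit) : lkMirror t = .nil ↔ t = .nil := by
  cases t <;> simp [lkMirror]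

theorem lkMirror_numNodes (t : BinaryTree Unit) : (lkMirror t).numNodes = t.numNodes := by
  induction t with
  | nil => rfl
  | node a l r hl hr => simp [lkMirror, hl, hr]; omega

theorem lkPk_mirror (t : BinaryTree Unit) :
    lkPk t + lkPk (lkMirror t) = t.numNodes + if t = .nil then 0 else 1 := by
  induction t with
  | nil => simp [lkPk, lkMirror]
  | node a l r hl hr =>
    simp only [lkMirror, lkPk, lkMirror_eq_nil, BinaryTree.numNodes]
    split_ifs at * <;> simp_all <;> omega

theorem lkWord_eq_nil (t : BinaryTree Unit) : lkWord t = [] ↔ t = .nil := by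
  cases t <;> simp [lkWord]

/-- Translate Dyck steps. -/
def lkB : DyckStep → Bool
  | .U => true
  | .D => false

/-- Translate booleans. -/
def lkC : Bool → DyckStep
  | true => .U
  | false => .D

theorem lkB_inj : Function.Injective lkB := by
  intro a b; cases a <;> cases b <;> simp [lkB]

theorem lkC_inj : Function.Injective lkC := by
  intro a b; cases a <;> cases b <;> simp [lkC]

theorem lkB_C (a : Bool) : lkB (lkC a) = a := by cases a <;> rfl

theorem lkWord_eq (t : BinaryTree Unit) : lkWord t = (DyckWord.ofTree t).toList.map lkB := by
  induction t with
  | nil => rfl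
  | node a l r hl hr =>
    have h : (DyckWord.ofTree (.node a l r)).toList
      = ([DyckStep.U] ++ (DyckWord.ofTree l).toList ++ [DyckStep.D]) ++ (DyckWord.ofTree r).toList := rfl
    rw [h]; simp [lkWord, hl, hr, lkB]

theorem lkWord_inj : Function.Injective lkWord := by
  intro s t h
  rw [lkWord_eq, lkWord_eq] at h
  have h2 := DyckWord.ext (List.map_injective_iff.2 lkB_inj h)
  exact DyckWord.equivTree.symm.injective h2

theorem lk_mem (n : ℕ) (s : List Bool) : s ∈ dyckWords n ↔
    s.count true = n ∧ s.count false = n ∧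
      ∀ k, (s.take k).count false ≤ (s.take k).count true := by
  unfold dyckWords
  simp only [Finset.mem_filter, List.mem_toFinset, List.mem_permutations, List.perm_iff_count,
    Bool.forall_bool]
  simp [List.count_replicate]
  tauto

theorem lk_count_true (l : List DyckStep) : (l.map lkB).count true = l.count .U :=
  List.count_map_of_injective l lkB lkB_inj .U

theorem lk_count_false (l : List DyckStep) : (l.map lkB).count false = l.count .D :=
  List.count_map_of_injective l lkB lkB_inj .D

theorem lk_dyck_eq (n : ℕ) :
    dyckWords n = (BinaryTree.treesOfNumNodesEq n).image lkWord := by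
  ext s
  rw [lk_mem, Finset.mem_image]
  constructor
  · rintro ⟨h1, h2, h3⟩
    have hs : (s.map lkC).map lkB = s := by
      simp [List.map_map, Function.comp_def, lkB_C]
    have ht : ∀ k, ((s.map lkC).take k).map lkB = s.take k := by
      intro k; rw [List.map_take, hs]
    let p : DyckWord := ⟨s.map lkC, by
      rw [← lk_count_true, ← lk_count_false, hs, h1, h2], by
      intro k
      rw [← lk_count_true, ← lk_count_false, ht]
      exact h3 k⟩
    refine ⟨p.toTree, ?_, ?_⟩
    · rw [BinaryTree.mem_treesOfNumNodesEq, DyckWord.numNodes_toTree]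
      change (s.map lkC).count .U = n
      rw [← lk_count_true, hs, h1]
    · rw [lkWord_eq, DyckWord.ofTree_toTree]; exact hs
  · rintro ⟨t, ht, rfl⟩
    rw [BinaryTree.mem_treesOfNumNodesEq] at ht
    have hn : (DyckWord.ofTree t).semilength = n := by
      rw [← DyckWord.numNodes_toTree, DyckWord.toTree_ofTree, ht]
    rw [lkWord_eq]
    refine ⟨?_, ?_, ?_⟩
    · rw [lk_count_true]; exact hn
    · rw [lk_count_false, ← DyckWord.semilength_eq_count_D]; exact hn
    · intro k
      rw [← List.map_take, lk_count_true, lk_count_false]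
      exact (DyckWord.ofTree t).count_D_le_count_U k

theorem lk_pea_cons (a : Bool) (s : List Bool) :
    pea (a :: s) = pea s + if a = true ∧ s.headD true = false then 1 else 0 := by
  unfold pea
  rw [Finset.card_filter, Finset.card_filter, List.length_cons, Finset.sum_range_succ']
  congr 1
  · refine Finset.sum_congr rfl fun i _ => ?_
    simp [isPeak]
  · cases s <;> simp [isPeak]

theorem lk_pea_app (t : BinaryTree Unit) :
    (∀ s, pea (lkWord t ++ false :: s) = lkPk t + pea s) ∧ pea (lkWord t) = lkPk t := by
  have hd : ∀ (l : BinaryTree Unit) (s : List Bool),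
      (lkWord l ++ false :: s).headD true = false ↔ l = .nil := by
    intro l s
    cases l <;> simp [lkWord]
  induction t with
  | nil => exact ⟨fun s => by simp [lkWord, lkPk, lk_pea_cons], by
      simp only [lkWord, lkPk, pea, Finset.card_eq_zero]
      exact Finset.eq_empty_of_forall_notMem (fun x hx =>
        absurd (Finset.mem_filter.1 hx).1 (by simp))⟩
  | node a l r hl hr =>
    constructor
    · intro s
      simp only [lkWord, List.cons_append, List.append_assoc]
      rw [lk_pea_cons, hl.1, hr.1]
      simp only [hd, lkPk, true_and]; omega
    · simp only [lkWord]
      rw [lk_pea_cons, hl.1, hr.2]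
      simp only [hd, lkPk, true_and]

theorem lk_card (n r : ℕ) : ((dyckWords n).filter (fun D => pea D = r)).card
    = ((BinaryTree.treesOfNumNodesEq n).filter (fun t => lkPk t = r)).card := by
  rw [lk_dyck_eq, Finset.filter_image, Finset.card_image_of_injective _ lkWord_inj]
  simp only [(lk_pea_app _).2]

theorem lk_count_lt (s : List Bool) (b : Bool) (i j k : ℕ) (hi : i ≤ j) (hk : j + 1 ≤ k)
    (hj : j < s.length) (h : s[j] = b) : (s.take i).count b < (s.take k).count b := by
  have h1 : (s.take i).count b ≤ (s.take j).count b :=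
    (List.take_sublist_take_left hi).count_le b
  have h2 : (s.take (j+1)).count b ≤ (s.take k).count b :=
    (List.take_sublist_take_left hk).count_le b
  have h3 : (s.take (j+1)).count b = (s.take j).count b + 1 := by
    rw [List.take_succ_eq_append_getElem hj]; simp [h]
  omega

theorem lk_card_fst (s : List Bool) : ((peakCorners s).image Prod.fst).card = pea s := by
  unfold peakCorners pea
  rw [Finset.image_image, Finset.card_image_of_injOn]
  have key : ∀ i j, isPeak s i → isPeak s j → i < j →
      (s.take (i+1)).count true < (s.take (j+1)).count true := by
    rintro i j ⟨h1, h2, h3⟩ ⟨h4, h5, h6⟩ hij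
    exact lk_count_lt s true (i+1) j (j+1) hij le_rfl (by omega)
      (by rwa [List.getD_eq_getElem _ _ (by omega)] at h5)
  intro i hi j hj hij
  simp only [Finset.coe_filter, Set.mem_ofPred_eq] at hi hj
  simp only [Function.comp_apply] at hij
  rcases lt_trichotomy i j with h | h | h
  · have := key i j hi.2 hj.2 h; omega
  · exact h
  · have := key j i hj.2 hi.2 h; omega

theorem lk_card_snd (s : List Bool) : ((peakCorners s).image Prod.snd).card = pea s := by
  unfold peakCorners pea
  rw [Finset.image_image, Finset.card_image_of_injOn]
  have key : ∀ i j, isPeak s i → isPeak s j → i < j →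
      (s.take i).count false < (s.take j).count false := by
    rintro i j ⟨h1, h2, h3⟩ ⟨h4, h5, h6⟩ hij
    rw [List.getD_eq_getElem _ _ (by omega)] at h3 h5
    have hne : i + 1 ≠ j := by
      rintro rfl
      rw [h3] at h5
      exact Bool.noConfusion h5
    exact lk_count_lt s false i (i+1) j (by omega) (by omega) (by omega) h3
  intro i hi j hj hij
  simp only [Finset.coe_filter, Set.mem_ofPred_eq] at hi hj
  simp only [Function.comp_apply] at hij
  rcases lt_trichotomy i j with h | h | h
  · have := key i j hi.2 hj.2 h; omega
  · exact h
  · have := key j i hj.2 hi.2 h; omega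

theorem lk_snd_sub (n : ℕ) (s : List Bool) (hs : s ∈ dyckWords n) :
    (peakCorners s).image Prod.snd ⊆ Finset.Icc 0 n := by
  intro y hy
  rw [lk_mem] at hs
  unfold peakCorners at hy
  simp only [Finset.image_image, Finset.mem_image, Function.comp_apply] at hy
  obtain ⟨i, -, rfl⟩ := hy
  have := (List.take_sublist i s).count_le false
  simp only [Finset.mem_Icc]
  omega

/-- The Lalanne–Kreweras involution: if D' ∈ D_n is the path whose peak corners
are (y'_i, x'_i), where {x'_i} and {y'_i} are the complements in {0,...,n} of the
x- and y-coordinates of the peak corners of D, then pea D = n + 1 - pea D'.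
In particular, the number of Dyck paths with r peaks equals the number with
n + 1 - r peaks. -/
theorem lalanne_kreweras (n : ℕ) :
    (∀ D ∈ dyckWords n, ∀ D' ∈ dyckWords n,
      (peakCorners D').image Prod.fst = Finset.Icc 0 n \ (peakCorners D).image Prod.snd →
      (peakCorners D').image Prod.snd = Finset.Icc 0 n \ (peakCorners D).image Prod.fst →
      pea D = n + 1 - pea D')
    ∧ ∀ r, 1 ≤ r → r ≤ n →
      ((dyckWords n).filter (fun D => pea D = r)).card
        = ((dyckWords n).filter (fun D => pea D = n + 1 - r)).card := by
  constructor
  · intro D hD D' hD' h1 _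
    have h := congrArg Finset.card h1
    have hle := Finset.card_le_card (lk_snd_sub n D hD)
    rw [Finset.card_sdiff_of_subset (lk_snd_sub n D hD), lk_card_fst, lk_card_snd] at h
    rw [lk_card_snd] at hle
    simp only [Nat.card_Icc] at h hle
    omega
  · intro r hr hrn
    rw [lk_card, lk_card]
    have key : ∀ t : BinaryTree Unit, t.numNodes = n → lkPk t + lkPk (lkMirror t) = n + 1 := by
      intro t ht
      have hne : t ≠ .nil := by
        rintro rfl
        simp at ht
        omega
      have := lkPk_mirror t
      rw [if_neg hne, ht] at this
      exact this
    refine Finset.card_bij' (fun t _ => lkMirror t) (fun t _ => lkMirror t) ?_ ?_ ?_ ?_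
    · intro t ht
      simp only [Finset.mem_filter, BinaryTree.mem_treesOfNumNodesEq, lkMirror_numNodes] at ht ⊢
      have := key t ht.1
      exact ⟨ht.1, by omega⟩
    · intro t ht
      simp only [Finset.mem_filter, BinaryTree.mem_treesOfNumNodesEq, lkMirror_numNodes] at ht ⊢
      have := key t ht.1
      exact ⟨ht.1, by omega⟩
    · intro t _; exact lkMirror_mirror t
    · intro t _; exact lkMirror_mirror t
end

section
/- For σ, τ permutations of [n] with Des(σ) = Des(τ), the joint distribution of (des, plat) on nonnesting permutations with first-copy subsequence σ coincides with that on those with first-copy subsequence τ, i.e., C_n^σ(t,u) = C_n^τ(t,u). -/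
attribute [local instance] Classical.propDecidable

/-- The descent set of a word. -/
def desSet (w : List ℕ) : Finset ℕ :=
  (Finset.range w.length).filter (fun i => i + 1 < w.length ∧ w.getD (i+1) 0 < w.getD i 0)


open List in
theorem avoids_iff (w : List ℕ) : avoids w ↔ ∀ a b, a ≠ b → ¬ [a,b,b,a] <+ w := by
  constructor
  · intro h a b hab hs
    rw [List.sublist_iff_exists_orderEmbedding_getElem?_eq] at hs
    obtain ⟨f, hf⟩ := hs
    have h0 := hf 0
    have h1 := hf 1
    have h2 := hf 2
    have h3 := hf 3
    simp at h0 h1 h2 h3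
    have l3 : f 3 < w.length := by
      by_contra hh
      rw [List.getElem?_eq_none (by omega)] at h3
      simp at h3
    have := h (f 0) (f 1) (f 2) (f 3) (by simp) (by simp) (by simp) l3
    simp [List.getD_eq_getElem?_getD, ← h0, ← h1, ← h2, ← h3] at this
    exact hab this
  · intro h i j l m hij hjl hlm hm e1 e2
    by_contra hne
    apply h _ _ hne
    have key : ∀ (i j : ℕ) (s : List ℕ), i < j → i < w.length → s <+ w.drop j → (w.getD i 0 :: s) <+ w.drop i := by
      intro i j s hij hi hs
      rw [List.drop_eq_getElem_cons hi, List.getD_eq_getElem _ _ hi]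
      refine (hs.trans ?_).cons_cons _
      exact List.drop_sublist_drop_left _ (by omega)
    have h4 := key m (m+1) [] (by omega) hm (by simp)
    have h3 := key l m _ hlm (by omega) h4
    have h2 := key j l _ hjl (by omega) h3
    have h1 := key i j _ hij (by omega) h2
    rw [← e1, ← e2] at h1
    exact h1.trans (List.drop_sublist _ _)

theorem mem_multiPerms_iff (n k : ℕ) (w : List ℕ) : w ∈ multiPerms n k ↔
    ∀ a, List.count a w = if 1 ≤ a ∧ a ≤ n then k else 0 := by
  have hb : ∀ a, List.count a (baseWord n k) = if 1 ≤ a ∧ a ≤ n then k else 0 := by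
    intro a
    unfold baseWord
    induction n with
    | zero => simp; omega
    | succ n ih =>
      rw [List.range_succ, List.flatMap_append, List.count_append, ih]
      simp [List.count_replicate]
      grind
  unfold multiPerms
  simp only [List.mem_toFinset, List.mem_permutations]
  constructor
  · intro h a
    rw [h.count_eq, hb]
  · intro h
    rw [List.perm_iff_count]
    intro a
    rw [h, hb]

/-- swap of two values -/
def sw (v v' a : ℕ) : ℕ := if a = v then v' else if a = v' then v else a

theorem sw_sw (v v' a : ℕ) : sw v v' (sw v v' a) = a := by grind [sw]

def Adj (v v' a b : ℕ) : Prop := (a = v ∧ b = v') ∨ (a = v' ∧ b = v)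

theorem adj_sw (v v' a b : ℕ) : Adj v v' (sw v v' a) (sw v v' b) ↔ Adj v v' a b := by grind [sw, Adj]

noncomputable def Phi (v v' : ℕ) : List ℕ → List ℕ
  | [] => []
  | [a] => [sw v v' a]
  | a :: b :: l => if Adj v v' a b then a :: b :: l.map (sw v v') else sw v v' a :: Phi v v' (b :: l)

theorem phi_noadj (v v' : ℕ) (w : List ℕ) (h : w.IsChain (fun a b => ¬ Adj v v' a b)) :
    Phi v v' w = w.map (sw v v') := by
  induction w with
  | nil => simp [Phi]
  | cons a l ih =>
    cases l with
    | nil => simp [Phi]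
    | cons b l =>
      rw [List.isChain_cons_cons] at h
      rw [Phi, if_neg h.1, ih h.2]; simp

theorem phi_adj (v v' : ℕ) (α β : List ℕ) (x y : ℕ) (hxy : Adj v v' x y)
    (h : (α ++ [x]).IsChain (fun a b => ¬ Adj v v' a b)) :
    Phi v v' (α ++ x :: y :: β) = α.map (sw v v') ++ x :: y :: β.map (sw v v') := by
  induction α with
  | nil => simp [Phi, hxy]
  | cons a l ih =>
    cases l with
    | nil =>
      simp at h
      simp [Phi, hxy, h]
    | cons b l =>
      simp only [List.cons_append] at h ih ⊢
      rw [List.isChain_cons_cons] at h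
      rw [Phi, if_neg h.1, ih h.2]; simp

theorem exists_adj (v v' : ℕ) (w : List ℕ) (h : ¬ w.IsChain (fun a b => ¬ Adj v v' a b)) :
    ∃ α x y β, w = α ++ x :: y :: β ∧ Adj v v' x y := by
  induction w with
  | nil => simp at h
  | cons a l ih =>
    cases l with
    | nil => simp at h
    | cons b l =>
      rw [List.isChain_cons_cons] at h
      by_cases hab : Adj v v' a b
      · exact ⟨[], a, b, l, by simp, hab⟩
      · obtain ⟨α, x, y, β, e, h'⟩ := ih (by tauto)
        exact ⟨a :: α, x, y, β, by simp [e], h'⟩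

open List in
theorem last_order (w : List ℕ) (c q : ℕ) (hcq : c ≠ q) (h : [c, q] <+ w.dedup) :
    ∃ γ δ, w = γ ++ q :: δ ∧ c ∉ δ ∧ c ∈ γ := by
  induction w with
  | nil => simp at h
  | cons a l ih =>
    by_cases ha : a ∈ l
    · rw [List.dedup_cons_of_mem ha] at h
      obtain ⟨γ, δ, e, h1, h2⟩ := ih h
      exact ⟨a :: γ, δ, by simp [e], h1, by simp [h2]⟩
    · rw [List.dedup_cons_of_notMem ha] at h
      by_cases hac : a = c
      · subst hac
        have : q ∈ l := by
          have : q ∈ a :: l.dedup := h.subset (by simp)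
          simp [hcq.symm] at this
          exact this
        obtain ⟨γ, δ, rfl⟩ := List.append_of_mem this
        refine ⟨a :: γ, δ, by simp, ?_, by simp⟩
        simp at ha; tauto
      · have h' : [c, q] <+ l.dedup := by
          rcases List.sublist_cons_iff.1 h with h | ⟨r, hr, _⟩
          · exact h
          · simp at hr; exact absurd hr.1.symm hac
        obtain ⟨γ, δ, e, h1, h2⟩ := ih h'
        exact ⟨a :: γ, δ, by simp [e], h1, by simp [h2]⟩

open List in
theorem sub_right_of_notMem (t L : List ℕ) (a : ℕ) (s : List ℕ) (h : a :: s <+ t ++ L) (ha : a ∉ t) :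
    a :: s <+ L := by
  induction t with
  | nil => simpa using h
  | cons b t ih =>
    simp at ha
    rcases List.sublist_cons_iff.1 h with h | ⟨r, hr, _⟩
    · exact ih h ha.2
    · simp at hr; exact absurd hr.1 ha.1

theorem dedup_append_form (l m : List ℕ) : ∃ t, (l ++ m).dedup = t ++ m.dedup ∧
    t ⊆ l := by
  induction l with
  | nil => exact ⟨[], by simp⟩
  | cons a l ih =>
    obtain ⟨t, e, h⟩ := ih
    by_cases ha : a ∈ l ++ m
    · refine ⟨t, ?_, ?_⟩
      · rw [List.cons_append, List.dedup_cons_of_mem ha, e]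
      · intro x hx; simp [h hx]
    · refine ⟨a :: t, ?_, ?_⟩
      · rw [List.cons_append, List.dedup_cons_of_notMem ha, e]; simp
      · intro x hx; simp at hx ⊢; rcases hx with hx | hx
        · simp [hx]
        · simp [h hx]

open List in
theorem two_sub (l : List ℕ) (a b : ℕ) (hab : a ≠ b) (ha : a ∈ l) (hb : b ∈ l) :
    [a, b] <+ l ∨ [b, a] <+ l := by
  obtain ⟨s, t, rfl⟩ := List.append_of_mem ha
  simp [hab.symm] at hb
  rcases hb with hb | hb
  · right
    exact (List.singleton_sublist.2 hb).append (List.singleton_sublist.2 (by simp) : [a] <+ a :: t)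
  · left
    exact ((List.singleton_sublist.2 hb).cons_cons a).trans (List.sublist_append_right _ _)

open List in
theorem struct (w : List ℕ) (v v' c : ℕ) (hc2 : count c w = 2) (hv2 : count v w = 2) (hv'2 : count v' w = 2)
    (hav : ∀ a b, a ≠ b → ¬ [a,b,b,a] <+ w) (hs : [v, c, v'] <+ w.dedup)
    (α β : List ℕ) (x y : ℕ) (hw : w = α ++ x :: y :: β) (hxy : Adj v v' x y) :
    [v, c] <+ α ∧ [c, v'] <+ β ∧ v ∉ β ∧ v' ∉ α ∧ count v α = 1 ∧ count v' β = 1 := by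
  have hnd : [v, c, v'].Nodup := hs.nodup (List.nodup_dedup w)
  simp at hnd
  obtain ⟨⟨hvc, hvv'⟩, hcv'⟩ := hnd
  have cv : count v α + count v β = 1 := by
    rw [hw] at hv2
    rcases hxy with ⟨rfl, rfl⟩ | ⟨rfl, rfl⟩ <;> 
    · simp [List.count_append, List.count_cons, hvv', Ne.symm hvv'] at hv2; omega
  have cv' : count v' α + count v' β = 1 := by
    rw [hw] at hv'2
    rcases hxy with ⟨rfl, rfl⟩ | ⟨rfl, rfl⟩ <;> 
    · simp [List.count_append, List.count_cons, hvv', Ne.symm hvv'] at hv'2; omega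
  have cc : count c α + count c β = 2 := by
    rw [hw] at hc2
    rcases hxy with ⟨rfl, rfl⟩ | ⟨rfl, rfl⟩ <;> 
    · simp [List.count_append, List.count_cons, hvc, Ne.symm hvc, hcv', Ne.symm hcv'] at hc2; omega
  have hvxy : [v] <+ [x, y] := by
    rcases hxy with ⟨rfl, rfl⟩ | ⟨rfl, rfl⟩ <;> simp
  have hv'xy : [v'] <+ [x, y] := by
    rcases hxy with ⟨rfl, rfl⟩ | ⟨rfl, rfl⟩ <;> simp
  have hw' : w = α ++ ([x, y] ++ β) := by simp [hw]
  -- c must occur in α once we know the order in β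
  have hcα : [c, v'] <+ β.dedup → c ∈ α := by
    intro h
    by_contra hcα
    have : count c β = 2 := by
      have := List.count_eq_zero_of_not_mem hcα
      omega
    obtain ⟨γ, δ, e, h1, h2⟩ := last_order β c v' hcv' h
    have h3 : count c γ = 2 := by
      rw [e, List.count_append, List.count_cons, List.count_eq_zero_of_not_mem h1] at this
      simp [Ne.symm hcv'] at this
      exact this
    have h4 : [c, c] <+ γ := by
      have := List.replicate_sublist_iff.2 h3.ge
      simpa using this
    have h5 : [v', c, c, v'] <+ [x, y] ++ β := by
      refine hv'xy.append (r₁ := [c, c, v']) ?_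
      rw [e]
      exact h4.append (r₁ := [v']) (by simp)
    exact hav _ _ (Ne.symm hcv') (hw' ▸ h5.trans (List.sublist_append_right _ _))
  have hvβ : v ∉ β := by
    intro hvβ
    have h1 : 0 < count v β := List.count_pos_iff.2 hvβ
    have hvα : v ∉ α := fun h => by
      have := List.count_pos_iff.2 h
      omega
    obtain ⟨t, e, ht⟩ := dedup_append_form α (x :: y :: β)
    have h2 : [v, c, v'] <+ (x :: y :: β).dedup := by
      rw [hw, e] at hs
      exact sub_right_of_notMem _ _ _ _ hs (fun h => hvα (ht h))
    have h3 : v' ∈ β := by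
      by_contra h3
      obtain ⟨γ, δ, e', h4, h5⟩ := last_order (x :: y :: β) v v' hvv' 
        ((by simp : [v, v'] <+ [v, c, v']).trans h2)
      rcases hxy with ⟨rfl, rfl⟩ | ⟨rfl, rfl⟩
      all_goals
        rcases γ with _ | ⟨g, _ | ⟨g', γ⟩⟩ <;> simp at e' h4 h5 h3 <;> grind
    have h4 : (x :: y :: β).dedup = β.dedup := by
      have hx : y ∈ β := by rcases hxy with ⟨rfl, rfl⟩ | ⟨rfl, rfl⟩ <;> assumption
      have hy : x ∈ β := by rcases hxy with ⟨rfl, rfl⟩ | ⟨rfl, rfl⟩ <;> assumption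
      rw [List.dedup_cons_of_mem (by simp [hy]), List.dedup_cons_of_mem hx]
    rw [h4] at h2
    have h5 := hcα ((by simp : [c, v'] <+ [v, c, v']).trans h2)
    have h6 : [c, v, v, c] <+ w := by
      rw [hw']
      refine (List.singleton_sublist.2 h5).append (r₁ := [v, v, c]) ?_
      refine hvxy.append (r₁ := [v, c]) ?_
      exact ((by simp : [v, c] <+ [v, c, v']).trans h2).trans (List.dedup_sublist _)
    exact hav _ _ (Ne.symm hvc) h6
  have c0 := List.count_eq_zero_of_not_mem hvβ
  have hvα : v ∈ α := List.count_pos_iff.1 (by omega)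
  -- the tail order
  obtain ⟨γ, δ, e', h4, h5⟩ := last_order w v v' hvv' 
        ((by simp : [v, v'] <+ [v, c, v']).trans hs)
  have hcv'd : [c, v'] <+ β.dedup := by
    obtain ⟨t, e, ht⟩ := dedup_append_form α (x :: y :: β)
    rw [hw, e] at hs
    have hn := List.nodup_dedup (α ++ x :: y :: β)
    rw [e] at hn
    have hvm : v ∈ (x :: y :: β).dedup := by
      rw [List.mem_dedup]
      rcases hxy with ⟨rfl, rfl⟩ | ⟨rfl, rfl⟩ <;> simp
    have hvt : v ∉ t := fun h => (List.nodup_append.1 hn).2.2 _ h _ hvm rfl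
    have h2 := sub_right_of_notMem _ _ _ _ hs hvt
    have strip : ∀ (a b : ℕ) (s L : List ℕ), a ≠ b → a :: s <+ b :: L → a :: s <+ L := by
      intro a b s L hab h
      exact sub_right_of_notMem [b] L a s h (by simpa using hab)
    have tl : ∀ (a : ℕ) (s L : List ℕ), a :: s <+ a :: L → s <+ L := by
      intro a s L h
      simpa using h
    rcases hxy with ⟨rfl, rfl⟩ | ⟨rfl, rfl⟩
    · rw [List.dedup_cons_of_notMem (by simp [hvβ, hvv'])] at h2
      have h3 := tl _ _ _ h2
      by_cases h6 : y ∈ β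
      · rwa [List.dedup_cons_of_mem h6] at h3
      · rw [List.dedup_cons_of_notMem h6] at h3
        exact strip _ _ _ _ hcv' h3
    · have h7 : ∀ L, x ∈ L → [y, c, x] <+ x :: L ∨ [y, c, x] <+ L → [y, c, x] <+ L := by
        intro L _ h
        exact h.elim (strip _ _ _ _ hvv') id
      have h8 : [y, c, x] <+ (y :: β).dedup := by
        by_cases h6 : x ∈ y :: β
        · rwa [List.dedup_cons_of_mem h6] at h2
        · rw [List.dedup_cons_of_notMem h6] at h2
          exact strip _ _ _ _ hvv' h2
      rw [List.dedup_cons_of_notMem hvβ] at h8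
      exact tl _ _ _ h8
  have hcβ : [c, v'] <+ β := hcv'd.trans (List.dedup_sublist _)
  have hv'β : v' ∈ β := hcβ.subset (by simp)
  have c1 : 0 < count v' β := List.count_pos_iff.2 hv'β
  refine ⟨?_, hcβ, hvβ, ?_, by omega, by omega⟩
  · rcases two_sub α v c hvc hvα (hcα hcv'd) with h | h
    · exact h
    · exfalso
      have h6 : [c, v, v, c] <+ w := by
        rw [hw']
        refine h.append (r₁ := [v, c]) ?_
        refine hvxy.append (r₁ := [c]) ?_
        exact (by simp : [c] <+ [c, v']).trans hcβ
      exact hav _ _ (Ne.symm hvc) h6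
  · intro h
    have := List.count_pos_iff.2 h
    omega

theorem sw_comm (v v' a : ℕ) : sw v v' a = sw v' v a := by grind [sw]
theorem adj_comm (v v' a b : ℕ) : Adj v v' a b ↔ Adj v' v a b := by grind [Adj]
theorem sw_inj (v v' : ℕ) : Function.Injective (sw v v') := fun a b h => by
  rw [← sw_sw v v' a, h, sw_sw]

theorem phi_comm (v v' : ℕ) (w : List ℕ) : Phi v v' w = Phi v' v w := by
  have e : sw v v' = sw v' v := funext (sw_comm v v')
  induction w with
  | nil => simp [Phi]
  | cons a l ih =>
    cases l with
    | nil => simp [Phi, e]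
    | cons b l =>
      simp only [Phi, ih, e]
      by_cases h : Adj v v' a b
      · rw [if_pos h, if_pos ((adj_comm _ _ _ _).1 h)]
      · rw [if_neg h, if_neg (fun h' => h ((adj_comm _ _ _ _).2 h'))]

def NA (v v' : ℕ) (w : List ℕ) : Prop := w.IsChain (fun a b => ¬ Adj v v' a b)

theorem NA_map (v v' : ℕ) (w : List ℕ) (h : NA v v' w) : NA v v' (w.map (sw v v')) := by
  unfold NA at *
  rw [List.isChain_map]
  simpa only [adj_sw] using h

open List in
theorem form (w : List ℕ) (v v' c : ℕ) (hc2 : count c w = 2) (hv2 : count v w = 2) (hv'2 : count v' w = 2)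
    (hav : ∀ a b, a ≠ b → ¬ [a,b,b,a] <+ w) (hs : [v, c, v'] <+ w.dedup) (hna : ¬ NA v v' w) :
    ∃ α z x y z' β, w = α ++ z :: x :: y :: z' :: β ∧ Adj v v' x y ∧ z ≠ v ∧ z ≠ v' ∧ z' ≠ v ∧ z' ≠ v' ∧
      NA v v' (α ++ [z]) ∧ NA v v' (z' :: β) ∧ v ∉ β ∧ v' ∉ α ∧ count v α = 1 ∧ count v' β = 1 := by
  have hnd : [v, c, v'].Nodup := hs.nodup (List.nodup_dedup w)
  simp at hnd
  obtain ⟨⟨hvc, hvv'⟩, hcv'⟩ := hnd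
  have S := struct w v v' c hc2 hv2 hv'2 hav hs
  obtain ⟨α, x, y, β, e, hxy⟩ := exists_adj v v' w hna
  obtain ⟨h1, h2, h3, h4, h5, h6⟩ := S α β x y e hxy
  rcases List.eq_nil_or_concat α with rfl | ⟨α, z, rfl⟩
  · simp at h1
  rcases β with _ | ⟨z', β⟩
  · simp at h2
  simp only [List.concat_eq_append] at *
  have hz : z ≠ v := by
    rintro rfl
    have : z ∉ α := by
      intro h
      have := List.count_pos_iff.2 h
      simp at h5
      omega
    have := sub_right_of_notMem _ _ _ _ h1 this
    simp at this
  have hz' : z' ≠ v' := by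
    rintro rfl
    have h7 : z' ∈ β := by
      have := sub_right_of_notMem [z'] β _ _ h2 (by simpa using hcv')
      exact this.subset (by simp)
    have := List.count_pos_iff.2 h7
    simp at h6
    omega
  simp at h3 h4
  refine ⟨α, z, x, y, z', β, by simp [e], hxy, hz, Ne.symm h4.2, Ne.symm h3.1, hz', ?_, ?_, h3.2, h4.1, ?_, ?_⟩
  · by_contra hh
    obtain ⟨α2, x2, y2, β2, e2, hxy2⟩ := exists_adj v v' _ hh
    have := (S α2 (β2 ++ x :: y :: z' :: β) x2 y2 (by rw [e, e2]; simp) hxy2).2.2.1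
    rcases hxy with ⟨rfl, rfl⟩ | ⟨rfl, rfl⟩ <;> simp at this
  · by_contra hh
    obtain ⟨α2, x2, y2, β2, e2, hxy2⟩ := exists_adj v v' _ hh
    have := (S (α ++ [z] ++ x :: y :: α2) β2 x2 y2 (by rw [e, e2]; simp) hxy2).2.2.2.1
    rcases hxy with ⟨rfl, rfl⟩ | ⟨rfl, rfl⟩ <;> simp at this
  · simpa [List.count_append, List.count_cons, hz] using h5
  · simpa [List.count_append, List.count_cons, hz'] using h6

/-- generic adjacent pair statistic -/
def stat (r : ℕ → ℕ → Bool) (w : List ℕ) : ℕ := ((w.zip w.tail).filter (fun p => r p.1 p.2)).length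

theorem stat_split (r : ℕ → ℕ → Bool) (α β : List ℕ) (z : ℕ) :
    stat r (α ++ z :: β) = stat r (α ++ [z]) + stat r (z :: β) := by
  induction α with
  | nil => simp [stat]
  | cons a l ih =>
    cases l with
    | nil =>
      simp [stat, List.filter_cons]
      split <;> simp <;> omega
    | cons b l =>
      simp only [stat, List.cons_append, List.tail_cons, List.zip_cons_cons, List.filter_cons] at ih ⊢
      split <;> (try simp only [List.length_cons]) <;> omega

theorem stat_map (r : ℕ → ℕ → Bool) (v v' : ℕ)
    (hr : ∀ a b, ¬ Adj v v' a b → r (sw v v' a) (sw v v' b) = r a b) (w : List ℕ) (h : NA v v' w) :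
    stat r (w.map (sw v v')) = stat r w := by
  induction w with
  | nil => simp
  | cons a l ih =>
    cases l with
    | nil => simp [stat]
    | cons b l =>
      unfold NA at *
      rw [List.isChain_cons_cons] at h
      have := ih h.2
      simp only [stat, List.map_cons, List.tail_cons, List.zip_cons_cons, List.filter_cons, hr _ _ h.1] at this ⊢
      split <;> (try simp only [List.length_cons]) <;> omega

open List in
theorem step (w : List ℕ) (v v' c : ℕ) (hc2 : count c w = 2) (hv2 : count v w = 2) (hv'2 : count v' w = 2)
    (hav : ∀ a b, a ≠ b → ¬ [a,b,b,a] <+ w) (hs : [v, c, v'] <+ w.dedup) :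
    Perm (Phi v v' w) (w.map (sw v v')) ∧ (∀ a b, a ≠ b → ¬ [a,b,b,a] <+ Phi v v' w) ∧
    (Phi v v' w).dedup = w.dedup.map (sw v v') ∧ Phi v v' (Phi v v' w) = w ∧
    ∀ r : ℕ → ℕ → Bool, (∀ a b, ¬ Adj v v' a b → r (sw v v' a) (sw v v' b) = r a b) →
      stat r (Phi v v' w) = stat r w := by
  have hvv' : v ≠ v' := by
    have hnd : [v, c, v'].Nodup := hs.nodup (List.nodup_dedup w)
    simp at hnd
    exact hnd.1.2
  have hss : ∀ l : List ℕ, (l.map (sw v v')).map (sw v v') = l := by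
    intro l
    rw [List.map_map]
    have : sw v v' ∘ sw v v' = id := funext (sw_sw v v')
    rw [this]; simp
  have havm : ∀ a b, a ≠ b → ¬ [a,b,b,a] <+ w.map (sw v v') := by
    intro a b hab h
    have h' := h.map (sw v v')
    rw [hss] at h'
    exact hav _ _ (fun h => hab (sw_inj v v' h)) h'
  have hdm : (w.map (sw v v')).dedup = w.dedup.map (sw v v') :=
    List.dedup_map_of_injective (sw_inj v v') w
  by_cases hna : NA v v' w
  · have e := phi_noadj v v' w hna
    have e' := phi_noadj v v' _ (NA_map v v' w hna)
    rw [e, e', hss]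
    exact ⟨Perm.refl _, havm, hdm, rfl, fun r hr => stat_map r v v' hr w hna⟩
  · obtain ⟨α, z, x, y, z', β, e, hxy, hz, hzv, hzv', hz', n1, n2, hvβ, hvα, c1, c2⟩ :=
      form w v v' c hc2 hv2 hv'2 hav hs hna
    have sz : sw v v' z = z := by simp [sw, hz, hzv]
    have sz' : sw v v' z' = z' := by simp [sw, hz', hzv']
    have sx : sw v v' x = y := by grind [sw, Adj]
    have sy : sw v v' y = x := by grind [sw, Adj]
    have ext : ∀ α : List ℕ, NA v v' (α ++ [z]) → NA v v' ((α ++ [z]) ++ [x]) := by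
      intro α h
      unfold NA at *
      rw [List.append_assoc, List.singleton_append, List.isChain_split]
      refine ⟨h, ?_⟩
      simp [Adj, hz, hzv]
    have P : ∀ α β : List ℕ, NA v v' (α ++ [z]) → Phi v v' (α ++ z :: x :: y :: z' :: β)
        = α.map (sw v v') ++ z :: x :: y :: z' :: β.map (sw v v') := by
      intro α β h
      have := phi_adj v v' (α ++ [z]) (z' :: β) x y hxy (ext α h)
      simpa [sz, sz'] using this
    have n3 : NA v v' (α.map (sw v v') ++ [z]) := by
      have := NA_map v v' _ n1
      simpa [sz] using this
    have e1 := P α β n1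
    rw [← e] at e1
    have e2 := P _ (β.map (sw v v')) n3
    rw [hss, hss, ← e, ← e1] at e2
    have em : w.map (sw v v') = α.map (sw v v') ++ z :: y :: x :: z' :: β.map (sw v v') := by
      rw [e]; simp [sz, sz', sx, sy]
    have cm : ∀ (a : ℕ) (l : List ℕ), count a (l.map (sw v v')) = count (sw v v' a) l := by
      intro a l
      have := List.count_map_of_injective l (sw v v') (sw_inj v v') (sw v v' a)
      rwa [sw_sw] at this
    have sv : sw v v' v = v' := by simp [sw]
    have sv' : sw v v' v' = v := by simp [sw]
    refine ⟨?_, ?_, ?_, e2, ?_⟩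
    · rw [e1, em]
      exact ((Perm.swap _ _ _).cons _).append_left _
    · intro a b hab h
      by_cases hA : Adj v v' a b
      · have hf := h.filter (fun t => decide (t = v ∨ t = v'))
        rw [e1] at hf
        have f1 : (α.map (sw v v')).filter (fun t => decide (t = v ∨ t = v')) = [v'] := by
          have : (α.map (sw v v')).filter (fun t => decide (t = v ∨ t = v')) =
            (α.map (sw v v')).filter (fun t => t == v') := by
            apply List.filter_congr
            intro t ht
            have : t ≠ v := by
              rintro rfl
              have h1 := List.count_pos_iff.2 ht
              rw [cm, sv] at h1
              exact hvα (List.count_pos_iff.1 h1)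
            by_cases h3 : t = v' <;> simp [this, h3]
          rw [this, List.filter_beq, cm, sv', c1]; simp
        have f2 : (β.map (sw v v')).filter (fun t => decide (t = v ∨ t = v')) = [v] := by
          have : (β.map (sw v v')).filter (fun t => decide (t = v ∨ t = v')) =
            (β.map (sw v v')).filter (fun t => t == v) := by
            apply List.filter_congr
            intro t ht
            have : t ≠ v' := by
              rintro rfl
              have h1 := List.count_pos_iff.2 ht
              rw [cm, sv'] at h1
              exact hvβ (List.count_pos_iff.1 h1)
            by_cases h3 : t = v <;> simp [this, h3]
          rw [this, List.filter_beq, cm, sv, c2]; simp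
        have hx : x = v ∨ x = v' := by grind [Adj]
        have hy : y = v ∨ y = v' := by grind [Adj]
        have ha : a = v ∨ a = v' := by grind [Adj]
        have hb : b = v ∨ b = v' := by grind [Adj]
        simp only [List.filter_append, f1, List.filter_cons, f2, hx, hy, ha, hb, hz, hzv, hzv', hz'] at hf
        simp only [decide_true, if_true, or_self, decide_false, List.filter_nil] at hf
        have := hf.eq_of_length (by simp)
        simp at this
        grind
      · have hf := h.filter (fun t => decide (t = a ∨ t = b))
        have : (Phi v v' w).filter (fun t => decide (t = a ∨ t = b)) = 
            (w.map (sw v v')).filter (fun t => decide (t = a ∨ t = b)) := by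
          rw [e1, em]
          simp only [List.filter_append, List.filter_cons]
          have : ¬ ((x = a ∨ x = b) ∧ (y = a ∨ y = b)) := by grind [Adj]
          grind
        rw [this] at hf
        have h2 := hf.trans List.filter_sublist
        simp at h2
        exact havm a b hab h2
    · rw [← hdm, e1, em]
      have : (x :: y :: z' :: β.map (sw v v')).dedup = (y :: x :: z' :: β.map (sw v v')).dedup := by
        have hm : v ∈ z' :: β.map (sw v v') := by
          have : v ∈ β.map (sw v v') := List.count_pos_iff.1 (by rw [cm, sv, c2]; simp)
          simp [this]
        have hn : v' ∉ z' :: β.map (sw v v') := by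
          intro h
          have : v' ∈ β.map (sw v v') := by simpa [Ne.symm hz'] using h
          have := List.count_pos_iff.2 this
          rw [cm, sv'] at this
          exact hvβ (List.count_pos_iff.1 this)
        have k : (v :: v' :: z' :: β.map (sw v v')).dedup = (v' :: v :: z' :: β.map (sw v v')).dedup := by
          rw [List.dedup_cons_of_mem (List.mem_cons_of_mem _ hm), List.dedup_cons_of_notMem hn,
            List.dedup_cons_of_notMem (a := v') (l := v :: z' :: β.map (sw v v')) (by simp at hn ⊢; grind),
            List.dedup_cons_of_mem hm]
        rcases hxy with ⟨rfl, rfl⟩ | ⟨rfl, rfl⟩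
        · exact k
        · exact k.symm
      have h3 : ∀ L L' : List ℕ, L.dedup = L'.dedup → 
          (α.map (sw v v') ++ z :: L).dedup = (α.map (sw v v') ++ z :: L').dedup := by
        intro L L' h
        have := List.dedup_append (α.map (sw v v') ++ [z]) L
        have h' := List.dedup_append (α.map (sw v v') ++ [z]) L'
        rw [h, ← h'] at this
        simpa using this
      exact h3 _ _ this
    · intro r hr
      have s1 := stat_map r v v' hr _ n1
      have s2 := stat_map r v v' hr _ n2
      simp only [List.map_append, List.map_cons, List.map_nil, sz, sz'] at s1 s2
      have t : ∀ α β : List ℕ, stat r (α ++ z :: x :: y :: z' :: β) = 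
          stat r (α ++ [z]) + (stat r [z, x, y, z'] + stat r (z' :: β)) := by
        intro α β
        rw [stat_split]
        have := stat_split r [z, x, y] β z'
        simp at this
        rw [this]
      rw [e1, e, t, t, s1, s2]

noncomputable def CS (n : ℕ) (σ : List ℕ) : MvPolynomial (Fin 2) ℚ :=
  ∑ π ∈ (nonnest n).filter (fun π => π.dedup = σ),
        (MvPolynomial.X 0 : MvPolynomial (Fin 2) ℚ) ^ des π * (MvPolynomial.X 1) ^ plat π

theorem des_stat (w : List ℕ) : des w = stat (fun a b => decide (b < a)) w := rfl
theorem plat_stat (w : List ℕ) : plat w = stat (fun a b => decide (b = a)) w := rfl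

open List in
theorem mem_C (n : ℕ) (σ w : List ℕ) : w ∈ (nonnest n).filter (fun π => π.dedup = σ) ↔
    (∀ a, List.count a w = if 1 ≤ a ∧ a ≤ n then 2 else 0) ∧
    (∀ a b, a ≠ b → ¬ [a,b,b,a] <+ w) ∧ w.dedup = σ := by
  unfold nonnest
  rw [Finset.mem_filter, Finset.mem_filter, mem_multiPerms_iff, avoids_iff]
  tauto

open List in
theorem map_C (n : ℕ) (σ w : List ℕ) (v v' c : ℕ) (hs : [v, c, v'] <+ σ) (hvv : v' = v + 1 ∨ v = v' + 1)
    (hw : w ∈ (nonnest n).filter (fun π => π.dedup = σ)) :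
    Phi v v' w ∈ (nonnest n).filter (fun π => π.dedup = σ.map (sw v v')) ∧
    Phi v v' (Phi v v' w) = w ∧ des (Phi v v' w) = des w ∧ plat (Phi v v' w) = plat w := by
  rw [mem_C] at hw
  obtain ⟨h1, h2, h3⟩ := hw
  have hm : ∀ a ∈ [v, c, v'], 1 ≤ a ∧ a ≤ n := by
    intro a ha
    have h4 : a ∈ w := by
      rw [← List.mem_dedup, h3]
      exact hs.subset ha
    have h5 := List.count_pos_iff.2 h4
    rw [h1] at h5
    by_contra h6
    simp [h6] at h5
  have hmv := hm v (by simp)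
  have hmv' := hm v' (by simp)
  have hmc := hm c (by simp)
  obtain ⟨p, q, r, s, t⟩ := step w v v' c (by simp [h1, hmc]) (by simp [h1, hmv]) (by simp [h1, hmv']) h2 (by rwa [h3])
  refine ⟨?_, s, ?_, ?_⟩
  · rw [mem_C]
    refine ⟨?_, q, by rw [r, h3]⟩
    intro a
    rw [p.count_eq]
    have := List.count_map_of_injective w (sw v v') (sw_inj v v') (sw v v' a)
    rw [sw_sw] at this
    rw [this, h1]
    congr 1
    unfold sw
    apply propext
    split_ifs <;> omega
  · rw [des_stat, des_stat]
    apply t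
    intro a b hab
    apply decide_eq_decide.2
    unfold sw Adj at *
    split_ifs <;> omega
  · rw [plat_stat, plat_stat]
    apply t
    intro a b hab
    apply decide_eq_decide.2
    unfold sw Adj at *
    split_ifs <;> omega

open List in
theorem CS_swap (n : ℕ) (σ : List ℕ) (v v' c : ℕ) (hs : [v, c, v'] <+ σ) (hnd : σ.Nodup) (hvv : v' = v + 1 ∨ v = v' + 1) :
    CS n σ = CS n (σ.map (sw v v')) := by
  unfold CS
  have hs' : [v', c, v] <+ σ.map (sw v v') := by
    have := hs.map (sw v v')
    have hnd : [v, c, v'].Nodup := hs.nodup hnd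
    simp at hnd
    have e1 : sw v v' c = c := by grind [sw]
    have e2 : sw v v' v = v' := by grind [sw]
    have e3 : sw v v' v' = v := by grind [sw]
    simpa [e1, e2, e3] using this
  have hss : (σ.map (sw v v')).map (sw v' v) = σ := by
    rw [List.map_map]
    have : sw v' v ∘ sw v v' = id := funext (fun a => by simp [sw_comm v' v, sw_sw])
    rw [this]; simp
  refine Finset.sum_nbij' (Phi v v') (Phi v' v) ?_ ?_ ?_ ?_ ?_
  · intro w hw
    exact (map_C n σ w v v' c hs hvv hw).1
  · intro w hw
    have := (map_C n _ w v' v c hs' hvv.symm hw).1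
    rwa [hss] at this
  · intro w hw
    rw [phi_comm v' v]
    exact (map_C n σ w v v' c hs hvv hw).2.1
  · intro w hw
    rw [phi_comm v v']
    exact (map_C n _ w v' v c hs' hvv.symm hw).2.1
  · intro w hw
    have := (map_C n σ w v v' c hs hvv hw).2.2
    rw [this.1, this.2]

/-- squared distance -/
def dist2 (n : ℕ) (σ τ : List ℕ) : ℤ := ∑ i ∈ Finset.range n, ((σ.getD i 0 : ℤ) - τ.getD i 0) ^ 2

open List in
theorem sub_three (σ : List ℕ) (p q : ℕ) (h : p + 1 < q) (hq : q < σ.length) :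
    [σ.getD p 0, σ.getD (p+1) 0, σ.getD q 0] <+ σ := by
  have key : ∀ (i j : ℕ) (s : List ℕ), i < j → i < σ.length → s <+ σ.drop j → (σ.getD i 0 :: s) <+ σ.drop i := by
    intro i j s hij hi hs
    rw [List.drop_eq_getElem_cons hi, List.getD_eq_getElem _ _ hi]
    refine (hs.trans ?_).cons_cons _
    exact List.drop_sublist_drop_left _ (by omega)
  have h3 := key q (q+1) [] (by omega) hq (by simp)
  have h2 := key (p+1) q _ h (by omega) h3
  have h1 := key p (p+1) _ (by omega) (by omega) h2
  exact h1.trans (List.drop_sublist _ _)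

theorem P_facts (n : ℕ) (σ : List ℕ) (hσ : σ ∈ multiPerms n 1) :
    σ.Nodup ∧ σ.length = n ∧ ∀ a, a ∈ σ ↔ 1 ≤ a ∧ a ≤ n := by
  have h := (mem_multiPerms_iff n 1 σ).1 hσ
  have hm : ∀ a, a ∈ σ ↔ 1 ≤ a ∧ a ≤ n := by
    intro a
    rw [← List.count_pos_iff, h]
    split_ifs with h <;> simp [h]
  have hnd : σ.Nodup := by
    rw [List.nodup_iff_count_le_one]
    intro a; rw [h]; split_ifs <;> simp
  refine ⟨hnd, ?_, hm⟩
  rw [← List.toFinset_card_of_nodup hnd]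
  have : σ.toFinset = Finset.Icc 1 n := by ext a; simp [hm]
  rw [this]; simp

theorem getD_inj (σ : List ℕ) (h : σ.Nodup) (i j : ℕ) (hi : i < σ.length) (hj : j < σ.length)
    (e : σ.getD i 0 = σ.getD j 0) : i = j := by
  rw [List.getD_eq_getElem _ _ hi, List.getD_eq_getElem _ _ hj] at e
  exact (h.getElem_inj_iff).1 e

theorem find_swap (n : ℕ) (σ τ : List ℕ) (hσ : σ ∈ multiPerms n 1) (hτ : τ ∈ multiPerms n 1) (hne : σ ≠ τ) :
    ∃ p q, p < n ∧ q < n ∧ σ.getD q 0 = σ.getD p 0 + 1 ∧ τ.getD q 0 < τ.getD p 0 := by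
  obtain ⟨nd1, l1, m1⟩ := P_facts n σ hσ
  obtain ⟨nd2, l2, m2⟩ := P_facts n τ hτ
  by_contra hcon
  push Not at hcon
  apply hne
  have hpos : ∀ a, 1 ≤ a → a ≤ n → ∃ p, p < n ∧ σ.getD p 0 = a := by
    intro a h1 h2
    have := (m1 a).2 ⟨h1, h2⟩
    obtain ⟨p, hp, e⟩ := List.mem_iff_getElem.1 this
    exact ⟨p, by omega, by rw [List.getD_eq_getElem _ _ hp, e]⟩
  have hmem : ∀ (ρ : List ℕ), ρ.length = n → ∀ p, p < n → ρ.getD p 0 ∈ ρ := by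
    intro ρ hρ p hp
    rw [List.getD_eq_getElem _ _ (by omega)]
    exact List.getElem_mem _
  choose! g hg1 hg2 using hpos
  have hstep : ∀ a, 1 ≤ a → a + 1 ≤ n → τ.getD (g a) 0 < τ.getD (g (a+1)) 0 := by
    intro a h1 h2
    have k := hcon (g a) (g (a+1)) (hg1 a h1 (by omega)) (hg1 _ (by omega) h2)
      (by rw [hg2 a h1 (by omega), hg2 _ (by omega) h2])
    rcases lt_or_eq_of_le k with h | h
    · exact h
    · have := getD_inj τ nd2 _ _ (by rw [l2]; exact hg1 a h1 (by omega)) (by rw [l2]; exact (hg1 _ (by omega) h2)) h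
      have e1 := hg2 a h1 (by omega)
      have e2 := hg2 (a+1) (by omega) h2
      rw [this, e2] at e1
      omega
  have hr : ∀ a, 1 ≤ a → a ≤ n → 1 ≤ τ.getD (g a) 0 ∧ τ.getD (g a) 0 ≤ n := fun a h1 h2 =>
    (m2 _).1 (hmem τ l2 _ (hg1 a h1 h2))
  have lo : ∀ a, 1 ≤ a → a ≤ n → a ≤ τ.getD (g a) 0 := by
    intro a h1
    induction a, h1 using Nat.le_induction with
    | base => intro h; exact (hr 1 le_rfl h).1
    | succ a h1 ih =>
      intro h
      have := hstep a h1 h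
      have := ih (by omega)
      omega
  have hi : ∀ k a, 1 ≤ a → a + k = n → τ.getD (g a) 0 ≤ a := by
    intro k
    induction k with
    | zero => intro a h1 h; have := (hr a h1 (by omega)).2; omega
    | succ k ih =>
      intro a h1 h
      have := hstep a h1 (by omega)
      have := ih (a+1) (by omega) (by omega)
      omega
  apply List.ext_getElem (by omega)
  intro i h1 h2
  have h3 := (m1 _).1 (hmem σ l1 i (by omega))
  have e := hg2 _ h3.1 h3.2
  have e' := getD_inj σ nd1 _ _ (by rw [l1]; exact hg1 _ h3.1 h3.2) (by omega) e
  have k1 := lo _ h3.1 h3.2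
  have k2 := hi (n - σ.getD i 0) _ h3.1 (by omega)
  rw [e'] at k1 k2
  rw [List.getD_eq_getElem _ _ h1, List.getD_eq_getElem _ _ h2] at k1 k2
  omega

theorem main_induct (n : ℕ) (τ : List ℕ) (hτ : τ ∈ multiPerms n 1) : ∀ (N : ℕ) (σ : List ℕ),
    σ ∈ multiPerms n 1 → desSet σ = desSet τ → dist2 n σ τ < N → CS n σ = CS n τ := by
  intro N
  induction N with
  | zero =>
    intro σ _ _ h
    have : 0 ≤ dist2 n σ τ := Finset.sum_nonneg (fun i _ => sq_nonneg _)
    simp at h; omega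
  | succ N ih =>
    intro σ hσ hd hN
    by_cases hne : σ = τ
    · rw [hne]
    obtain ⟨p, q, hp, hq, e, hlt⟩ := find_swap n σ τ hσ hτ hne
    obtain ⟨nd1, l1, m1⟩ := P_facts n σ hσ
    obtain ⟨nd2, l2, m2⟩ := P_facts n τ hτ
    have hdm : ∀ i, i + 1 < n → (σ.getD (i+1) 0 < σ.getD i 0 ↔ τ.getD (i+1) 0 < τ.getD i 0) := by
      intro i hi
      have := congrArg (fun s => i ∈ s) hd
      simp only [desSet, Finset.mem_filter, Finset.mem_range, l1, l2] at this
      have h1 : i < n := by omega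
      simpa only [hi, h1, true_and, eq_iff_iff] using this
    have hpq : p ≠ q := by rintro rfl; omega
    have n1 : q ≠ p + 1 := by
      rintro rfl
      have := (hdm p hq).2 hlt
      omega
    have n2 : p ≠ q + 1 := by
      rintro rfl
      have := (hdm q hp).1 (by omega)
      omega
    set v := σ.getD p 0 with hv
    set f := sw v (v+1) with hf
    have hgm : ∀ i, i < n → (σ.map f).getD i 0 = f (σ.getD i 0) := by
      intro i hi
      rw [List.getD_eq_getElem _ _ (by simp; omega), List.getD_eq_getElem _ _ (by omega)]
      simp
    have hfp : f (σ.getD p 0) = v + 1 := by rw [← hv, hf]; simp [sw]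
    have hfq : f (σ.getD q 0) = v := by rw [e, hf]; simp [sw]
    have hfo : ∀ i, i < n → i ≠ p → i ≠ q → f (σ.getD i 0) = σ.getD i 0 := by
      intro i hi h1 h2
      have k1 : σ.getD i 0 ≠ v := fun h => h1 (getD_inj σ nd1 _ _ (by omega) (by omega) h)
      have k2 : σ.getD i 0 ≠ v + 1 := fun h => h2 (getD_inj σ nd1 _ _ (by omega) (by omega) (h.trans e.symm))
      rw [hf, sw, if_neg k1, if_neg k2]
    have hvm := (m1 v).1 (by rw [hv, List.getD_eq_getElem _ _ (by omega)]; exact List.getElem_mem _)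
    have hvm' := (m1 (v+1)).1 (by rw [← e, List.getD_eq_getElem _ _ (by omega)]; exact List.getElem_mem _)
    have hCS : CS n σ = CS n (σ.map f) := by
      rcases Nat.lt_or_gt_of_ne hpq with h | h
      · have := sub_three σ p q (by omega) (by omega)
        rw [e] at this
        exact CS_swap n σ v (v+1) _ this nd1 (Or.inl rfl)
      · have := sub_three σ q p (by omega) (by omega)
        rw [e] at this
        have k := CS_swap n σ (v+1) v _ this nd1 (Or.inr rfl)
        rw [k, hf, funext (sw_comm v (v+1))]
    rw [hCS]
    apply ih
    · rw [mem_multiPerms_iff] at hσ ⊢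
      intro a
      have := List.count_map_of_injective σ f (sw_inj v (v+1)) (f a)
      rw [hf, sw_sw] at this
      rw [hf, this, hσ]
      congr 1
      unfold sw
      apply propext
      split_ifs <;> omega
    · rw [← hd]
      ext i
      simp only [desSet, Finset.mem_filter, Finset.mem_range, List.length_map, l1]
      refine and_congr_right fun hi => and_congr_right fun hi1 => ?_
      rw [hgm i hi, hgm (i+1) hi1]
      have hA : ¬ Adj v (v+1) (σ.getD i 0) (σ.getD (i+1) 0) := by
        rintro (⟨h1, h2⟩ | ⟨h1, h2⟩)
        · have := getD_inj σ nd1 i p (by omega) (by omega) h1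
          have := getD_inj σ nd1 (i+1) q (by omega) (by omega) (h2.trans e.symm)
          omega
        · have := getD_inj σ nd1 (i+1) p (by omega) (by omega) h2
          have := getD_inj σ nd1 i q (by omega) (by omega) (h1.trans e.symm)
          omega
      rw [hf]
      generalize σ.getD i 0 = a at *
      generalize σ.getD (i+1) 0 = b at *
      unfold sw Adj at *
      split_ifs <;> omega
    · have hdiff : dist2 n (σ.map f) τ - dist2 n σ τ < 0 := by
        unfold dist2
        rw [← Finset.sum_sub_distrib]
        rw [← Finset.sum_subset (s₁ := {p, q})]
        · rw [Finset.sum_pair hpq, hgm p hp, hgm q hq, hfp, hfq, e, ← hv]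
          push_cast
          have : (τ.getD q 0 : ℤ) < τ.getD p 0 := by exact_mod_cast hlt
          nlinarith
        · intro i hi
          simp at hi ⊢
          rcases hi with rfl | rfl <;> assumption
        · intro i hi hi'
          simp only [Finset.mem_insert, Finset.mem_singleton, not_or] at hi'
          rw [Finset.mem_range] at hi
          rw [hgm i hi, hfo i hi hi'.1 hi'.2]
          simp
      push_cast at hN
      omega

/-- If Des(σ) = Des(τ), then C_n^σ(t,u) = C_n^τ(t,u). -/
theorem Cpoly_sigma_depends_only_on_desSet (n : ℕ) (σ τ : List ℕ)
    (hσ : σ ∈ multiPerms n 1) (hτ : τ ∈ multiPerms n 1) (h : desSet σ = desSet τ) :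
    (∑ π ∈ (nonnest n).filter (fun π => π.dedup = σ),
        (MvPolynomial.X 0 : MvPolynomial (Fin 2) ℚ) ^ des π * (MvPolynomial.X 1) ^ plat π)
      = ∑ π ∈ (nonnest n).filter (fun π => π.dedup = τ),
          (MvPolynomial.X 0 : MvPolynomial (Fin 2) ℚ) ^ des π * (MvPolynomial.X 1) ^ plat π := by
  have := main_induct n τ hτ ((dist2 n σ τ).toNat + 1) σ hσ h (by push_cast; omega)
  exact this
end

section
/- For k ≥ 3 and n ≥ 1, the distribution of descents on A_n^k is (1+t)^{n-1} A_n(t), which is a palindromic polynomial; hence the number of words in A_n^k with r descents equals the number with (2n - 2 - r) descents. -/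
attribute [local instance] Classical.propDecidable

/-- Permutations of the multiset with k copies of each element of [n] avoiding
1221 and 2112. -/
noncomputable def Ank (n k : ℕ) : Finset (List ℕ) := (multiPerms n k).filter avoids

open List in
/-- Sublist form of avoidance. -/
def av (w : List ℕ) : Prop := ∀ x y, x ≠ y → ¬ ([x, y, y, x] <+ w)

theorem avoids_iff_s18 (w : List ℕ) : avoids w ↔ av w := by
  constructor
  · intro h x y hxy hs
    obtain ⟨is, h1, h2⟩ := List.sublist_eq_map_getElem hs
    match is, h1, h2 with
    | [i, j, l, m], h1, h2 =>
      simp at h1 h2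
      obtain ⟨e1, e2, e3, e4⟩ := h1
      have := h i j l m h2.1.1 h2.2.1.1 h2.2.2 m.2
      simp [← e1, ← e2, ← e3, ← e4] at this
      exact hxy this
    | [], h1, _ => simp at h1
    | [_], h1, _ => simp at h1
    | [_, _], h1, _ => simp at h1
    | [_, _, _], h1, _ => simp at h1
    | _ :: _ :: _ :: _ :: _ :: _, h1, _ => simp at h1
  · intro h i j l m hij hjl hlm hm e1 e2
    by_contra hne
    apply h _ _ hne
    have := List.map_getElem_sublist (l := w)
      (is := [⟨i, by omega⟩, ⟨j, by omega⟩, ⟨l, by omega⟩, ⟨m, hm⟩]) (by simp; omega)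
    rw [List.getD_eq_getElem _ _ (by omega), List.getD_eq_getElem _ _ (by omega)] at e1 e2
    rw [List.getD_eq_getElem _ _ (by omega), List.getD_eq_getElem _ _ (by omega)]
    simpa [← e1, ← e2] using this

theorem av_sub {v w : List ℕ} (h : List.Sublist v w) (hw : av w) : av v :=
  fun x y hxy hs => hw x y hxy (hs.trans h)

theorem des_cons_cons (x y : ℕ) (w : List ℕ) :
    des (x :: y :: w) = (if y < x then 1 else 0) + des (y :: w) := by
  unfold des
  by_cases h : y < x <;> simp [h] <;> omega

theorem des_single (x : ℕ) : des [x] = 0 := by simp [des]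

theorem des_self (x : ℕ) (w : List ℕ) : des (x :: x :: w) = des (x :: w) := by
  simp [des_cons_cons]

theorem des_rep (j x : ℕ) (w : List ℕ) :
    des (x :: (List.replicate j x ++ w)) = des (x :: w) := by
  induction j with
  | zero => simp
  | succ j ih => rw [List.replicate_succ, List.cons_append, des_self, ih]

/-- Tails of the words with given order of values. -/
noncomputable def TT (m : ℕ) : ℕ → List ℕ → Finset (List ℕ)
  | a, [] => {[a]}
  | a, b :: r =>
    (TT m b r).image (fun t => a :: b :: (List.replicate (m + 1) b ++ t)) ∪
    (TT m b r).image (fun t => b :: a :: (List.replicate (m + 1) b ++ t))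

theorem TT_sum (m : ℕ) (r : List ℕ) : ∀ a, (a :: r).Nodup →
    ∑ t ∈ TT m a r, (Polynomial.X : Polynomial ℚ) ^ des (a :: t)
      = (1 + Polynomial.X) ^ r.length * Polynomial.X ^ des (a :: r) := by
  induction r with
  | nil => intro a _; simp [TT, des_self]
  | cons b r ih =>
    intro a h
    have hab : a ≠ b := by simp at h; tauto
    have ih := ih b (by simp at h ⊢; tauto)
    rw [TT, Finset.sum_union, Finset.sum_image, Finset.sum_image]
    · have e1 : ∀ t, des (a :: a :: b :: (List.replicate (m + 1) b ++ t))
          = des (b :: t) + (if b < a then 1 else 0) := by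
        intro t; rw [des_self, des_cons_cons, des_rep, add_comm]
      have e2 : ∀ t, des (a :: b :: a :: (List.replicate (m + 1) b ++ t))
          = des (b :: t) + (if b < a then 1 else 0) + 1 := by
        intro t
        rw [des_cons_cons, des_cons_cons, List.replicate_succ, List.cons_append,
          des_cons_cons, des_rep]
        split_ifs <;> omega
      simp only [e1, e2, pow_succ, pow_add, ← Finset.sum_mul, ih, des_cons_cons, List.length_cons]
      ring
    · intro x _ y _ hxy; simpa using hxy
    · intro x _ y _ hxy; simpa using hxy
    · rw [Finset.disjoint_left]
      intro x hx hy
      simp only [Finset.mem_image] at hx hy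
      obtain ⟨t, _, rfl⟩ := hx
      obtain ⟨s, _, h2⟩ := hy
      simp at h2
      exact hab h2.1.symm

theorem dedup_rep (j b : ℕ) (t : List ℕ) (h : b ∈ t) :
    (List.replicate j b ++ t).dedup = t.dedup := by
  induction j with
  | zero => simp
  | succ j ih =>
    rw [List.replicate_succ, List.cons_append, List.dedup_cons_of_mem (by simp [h]), ih]

theorem dedup_step (m a b : ℕ) (t : List ℕ) (hab : a ≠ b) (h : b ∈ t) (ha : a ∉ t) :
    (a :: b :: (List.replicate (m + 1) b ++ t)).dedup = a :: t.dedup ∧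
    (b :: a :: (List.replicate (m + 1) b ++ t)).dedup = a :: t.dedup := by
  constructor
  · rw [List.dedup_cons_of_notMem (by simp [hab, ha]), List.dedup_cons_of_mem (by simp [h]),
      dedup_rep _ _ _ h]
  · rw [List.dedup_cons_of_mem (by simp [h]), List.dedup_cons_of_notMem (by simp [hab, ha]),
      dedup_rep _ _ _ h]

theorem TT_dedup (m : ℕ) (r : List ℕ) : ∀ a, (a :: r).Nodup → ∀ t ∈ TT m a r,
    t.dedup = a :: r := by
  induction r with
  | nil => intro a _ t ht; simp [TT] at ht; subst ht; simp
  | cons b r ih =>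
    intro a h t ht
    have hab : a ≠ b := by simp at h; tauto
    have key : ∀ s ∈ TT m b r, s.dedup = b :: r ∧ b ∈ s ∧ a ∉ s := by
      intro s hs
      have := ih b (by simp at h ⊢; tauto) s hs
      refine ⟨this, ?_, ?_⟩
      · rw [← List.mem_dedup, this]; simp
      · rw [← List.mem_dedup, this]; simp at h ⊢; tauto
    simp only [TT, Finset.mem_union, Finset.mem_image] at ht
    rcases ht with ⟨s, hs, rfl⟩ | ⟨s, hs, rfl⟩ <;> obtain ⟨k1, k2, k3⟩ := key s hs
    · rw [(dedup_step m a b s hab k2 k3).1, k1]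
    · rw [(dedup_step m a b s hab k2 k3).2, k1]

theorem TT_count (m : ℕ) (r : List ℕ) : ∀ a, (a :: r).Nodup → ∀ t ∈ TT m a r,
    ∀ x, t.count x = if x = a then 1 else if x ∈ r then m + 3 else 0 := by
  induction r with
  | nil =>
    intro a _ t ht x; simp [TT] at ht; subst ht
    by_cases h : x = a
    · simp [h]
    · simp [h, List.count_cons, Ne.symm h]
  | cons b r ih =>
    intro a h t ht x
    have hab : a ≠ b := by simp at h; tauto
    have har : a ∉ r := by simp at h; tauto
    have hbr : b ∉ r := by simp at h; tauto
    have ih := ih b (by simp at h ⊢; tauto)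
    simp only [TT, Finset.mem_union, Finset.mem_image] at ht
    rcases ht with ⟨s, hs, rfl⟩ | ⟨s, hs, rfl⟩ <;> have k := ih s hs x <;>
      simp only [List.count_cons, List.count_append, List.count_replicate, k, beq_iff_eq,
        List.mem_cons] <;>
      by_cases h1 : x = a <;> by_cases h2 : x = b <;> grind

open List in
theorem av_cons (a : ℕ) (v : List ℕ) (hv : av v) (h : ∀ y, y ≠ a → ¬ ([y, y, a] <+ v)) :
    av (a :: v) := by
  intro x y hxy hs
  rw [List.cons_sublist_cons'] at hs
  rcases hs with hs | ⟨rfl, hs⟩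
  · exact hv x y hxy hs
  · exact h y hxy.symm hs

open List in
theorem av_rep (j a : ℕ) (v : List ℕ) (hv : av v) (h : ∀ y, y ≠ a → ¬ ([y, y, a] <+ v)) :
    av (List.replicate j a ++ v) ∧
      ∀ y, y ≠ a → ¬ ([y, y, a] <+ List.replicate j a ++ v) := by
  induction j with
  | zero => simpa using ⟨hv, h⟩
  | succ j ih =>
    rw [List.replicate_succ, List.cons_append]
    refine ⟨av_cons _ _ ih.1 ih.2, ?_⟩
    intro y hy hs
    rw [List.cons_sublist_cons'] at hs
    rcases hs with hs | ⟨rfl, hs⟩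
    · exact ih.2 y hy hs
    · exact hy rfl

open List in
theorem TT_av (m : ℕ) (r : List ℕ) : ∀ a, (a :: r).Nodup → ∀ t ∈ TT m a r,
    av (List.replicate (m + 2) a ++ t) := by
  induction r with
  | nil =>
    intro a _ t ht; simp [TT] at ht; subst ht
    apply (av_rep _ _ _ _ _).1
    · intro x y _ hs; have := hs.length_le; simp at this
    · intro x _ hs; have := hs.length_le; simp at this
  | cons b r ih =>
    intro a h t ht
    have hab : a ≠ b := by simp at h; tauto
    have har : a ∉ r := by simp at h; tauto
    have hnd : (b :: r).Nodup := by simp at h ⊢; tauto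
    simp only [TT, Finset.mem_union, Finset.mem_image] at ht
    have key : ∀ s ∈ TT m b r, a ∉ s := by
      intro s hs
      rw [← List.mem_dedup, TT_dedup m r b hnd s hs]; simp [hab, har]
    rcases ht with ⟨s, hs, rfl⟩ | ⟨s, hs, rfl⟩
    · have k := ih b hnd s hs
      have ha := key s hs
      rw [List.replicate_succ, List.cons_append] at k
      have hno : a ∉ b :: (List.replicate (m + 1) b ++ s) := by simp [hab, ha]
      have hno' : ∀ y, y ≠ a → ¬ ([y, y, a] <+ b :: (List.replicate (m + 1) b ++ s)) := by
        intro y _ hs; exact hno (hs.subset (by simp))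
      have := (av_rep (m + 3) a _ k hno').1
      rw [List.replicate_succ'] at this
      simpa using this
    · have k := ih b hnd s hs
      have ha := key s hs
      rw [List.replicate_succ, List.cons_append] at k
      have hno : a ∉ (List.replicate (m + 1) b ++ s) := by simp [hab, ha]
      generalize List.replicate (m + 1) b ++ s = v at *
      have c1 : av (a :: v) := by
        apply av_cons _ _ (av_sub (List.sublist_cons_self _ _) k)
        intro y _ hs; exact hno (hs.subset (by simp))
      have c2 : av (b :: a :: v) := by
        apply av_cons _ _ c1
        intro y hy hs
        rw [List.cons_sublist_cons'] at hs
        rcases hs with hs | ⟨rfl, hs⟩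
        · exact k b y hy.symm (hs.cons_cons b)
        · exact hno (hs.subset (by simp))
      apply (av_rep _ _ _ c2 _).1
      intro y hy hq
      clear hs
      rename' hq => hs
      rw [List.cons_sublist_cons', List.cons_sublist_cons', List.cons_sublist_cons'] at hs
      rcases hs with (hs | ⟨rfl, hs⟩) | ⟨rfl, hs⟩
      · exact hno (hs.subset (by simp))
      · exact hy rfl
      · rcases hs with hs | ⟨rfl, hs⟩
        · exact hno (hs.subset (by simp))
        · exact hy rfl

open List in
theorem two_two (b d : ℕ) (X : List ℕ) : 2 ≤ X.count b → 2 ≤ X.count d → b ≠ d →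
    ([b, b, d] <+ X) ∨ ([d, d, b] <+ X) := by
  induction X using List.reverseRecOn with
  | nil => simp
  | append_singleton X x ih =>
    intro h1 h2 hbd
    by_cases hb : x = b
    · subst hb
      right
      have : 2 ≤ X.count d := by simpa [List.count_append, List.count_cons, hbd] using h2
      have := (List.replicate_sublist_iff (l := X) (n := 2)).2 this
      exact List.Sublist.append this (List.Sublist.refl [x])
    · by_cases hd : x = d
      · subst hd
        left
        have : 2 ≤ X.count b := by simpa [List.count_append, List.count_cons, hb] using h1
        have := (List.replicate_sublist_iff (l := X) (n := 2)).2 this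
        exact List.Sublist.append this (List.Sublist.refl [x])
      · have e1 : 2 ≤ X.count b := by simpa [List.count_append, List.count_cons, hb] using h1
        have e2 : 2 ≤ X.count d := by simpa [List.count_append, List.count_cons, hd] using h2
        have s := List.sublist_append_left X [x]
        exact (ih e1 e2 hbd).imp (fun h => h.trans s) (fun h => h.trans s)

theorem not_av (b d : ℕ) (X : List ℕ) (h1 : 2 ≤ X.count b) (h2 : 2 ≤ X.count d) (hbd : b ≠ d) :
    ¬ av (b :: d :: X) := by
  intro h
  rcases two_two b d X h1 h2 hbd with hs | hs
  · exact h d b hbd.symm ((hs.cons_cons d).cons b)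
  · exact h b d hbd ((hs.cons d).cons_cons b)

theorem peel (j : ℕ) : ∀ (b : ℕ) (Y : List ℕ), av (b :: Y) → Y.count b = j + 1 →
    (∀ x, x ≠ b → Y.count x = 0 ∨ 3 ≤ Y.count x) → ∃ v, Y = List.replicate j b ++ v := by
  induction j with
  | zero => intro b Y _ _ _; exact ⟨Y, by simp⟩
  | succ j ih =>
    intro b Y hav hc ho
    cases Y with
    | nil => simp at hc
    | cons y Y =>
      by_cases hy : y = b
      · subst hy
        obtain ⟨v, hv⟩ := ih y Y (av_sub (List.sublist_cons_self _ _) hav)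
          (by simpa using hc)
          (by intro x hx; have := ho x hx; simpa [List.count_cons, Ne.symm hx] using this)
        exact ⟨v, by rw [hv]; simp [List.replicate_succ]⟩
      · exfalso
        refine not_av b y Y ?_ ?_ (Ne.symm hy) hav
        · have : Y.count b = j + 1 + 1 := by simpa [List.count_cons, hy] using hc
          omega
        · have := ho y hy
          simp at this; omega

theorem classify (m N : ℕ) : ∀ (u : List ℕ) (a : ℕ), u.length ≤ N → u.count a = 1 →
    (∀ x, x ≠ a → u.count x = 0 ∨ u.count x = m + 3) → av (a :: u) →
    ∃ r, u.dedup = a :: r ∧ u ∈ TT m a r := by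
  induction N with
  | zero => intro u a hN hc _ _; have : u = [] := by simpa using hN
            subst this; simp at hc
  | succ N ih =>
    intro u a hN hc ho hav
    -- common step
    have step : ∀ b Z, b ≠ a → (b :: Z).length ≤ N → (b :: Z).count a = 0 →
        (∀ x, x ≠ a → (b :: Z).count x = u.count x) → av (b :: Z) →
        ∃ v r, Z = List.replicate (m + 1) b ++ v ∧ v.dedup = b :: r ∧ v ∈ TT m b r ∧
          b ∈ v ∧ a ∉ v := by
      intro b Z hba hlen hca hcx havb
      have hb : Z.count b = m + 2 := by
        have := hcx b hba
        have h2 := ho b hba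
        simp at this; omega
      have hx : ∀ x, x ≠ b → Z.count x = 0 ∨ Z.count x = m + 3 := by
        intro x hx
        have e : (b :: Z).count x = Z.count x := by simp [List.count_cons, Ne.symm hx]
        by_cases hxa : x = a
        · subst hxa; left; omega
        · have := hcx x hxa; have := ho x hxa; omega
      obtain ⟨v, rfl⟩ := peel (m + 1) b Z havb hb (by intro x h; have := hx x h; omega)
      have hbv : v.count b = 1 := by simp [List.count_append] at hb; omega
      have hxv : ∀ x, x ≠ b → v.count x = 0 ∨ v.count x = m + 3 := by
        intro x h; have := hx x h
        simpa [List.count_append, List.count_replicate, Ne.symm h] using this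
      obtain ⟨r, h1, h2⟩ := ih v b (by simp at hlen; omega) hbv hxv
        (av_sub ((List.sublist_append_right _ _).cons_cons b) havb)
      refine ⟨v, r, rfl, h1, h2, ?_, ?_⟩
      · rw [← List.mem_dedup, h1]; simp
      · have := List.count_eq_zero.1 hca
        simp at this; tauto
    cases u with
    | nil => simp at hc
    | cons c u =>
      by_cases hca : c = a
      · subst hca
        have hc0 : u.count c = 0 := by simpa using hc
        cases u with
        | nil => exact ⟨[], by simp, by simp [TT]⟩
        | cons b Z =>
          have hba : b ≠ c := by rintro rfl; simp at hc0
          obtain ⟨v, r, rfl, h1, h2, h3, h4⟩ := step b Z hba (by simpa using hN) hc0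
            (by intro x hx; simp [List.count_cons, Ne.symm hx])
            (av_sub ((List.sublist_cons_self _ _).trans (List.sublist_cons_self _ _)) hav)
          refine ⟨b :: r, ?_, ?_⟩
          · rw [(dedup_step m c b v hba.symm h3 h4).1, h1]
          · simp only [TT, Finset.mem_union, Finset.mem_image]
            exact Or.inl ⟨v, h2, rfl⟩
      · cases u with
        | nil => simp [hca] at hc
        | cons d u =>
          by_cases hda : d = a
          · subst hda
            have hc0 : u.count d = 0 := by simpa [List.count_cons, hca] using hc
            obtain ⟨v, r, rfl, h1, h2, h3, h4⟩ := step c u hca (by simpa using hN)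
              (by simpa [List.count_cons, hca] using hc0)
              (by intro x hx; simp [List.count_cons, Ne.symm hx])
              (av_sub (((List.sublist_cons_self _ _).cons_cons _).trans
                (List.sublist_cons_self _ _)) hav)
            refine ⟨c :: r, ?_, ?_⟩
            · rw [(dedup_step m d c v (Ne.symm hca) h3 h4).2, h1]
            · simp only [TT, Finset.mem_union, Finset.mem_image]
              exact Or.inr ⟨v, h2, rfl⟩
          · exfalso
            have hau : u.count a = 1 := by simpa [List.count_cons, hca, hda] using hc
            by_cases hdc : d = c
            · subst hdc
              apply hav a d (Ne.symm hda)
              have : a ∈ u := by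
                by_contra hh; rw [List.count_eq_zero.2 hh] at hau; omega
              exact (((List.singleton_sublist.2 this).cons_cons _).cons_cons _).cons_cons _
            · refine not_av c d u ?_ ?_ (Ne.symm hdc) (av_sub (List.sublist_cons_self _ _) hav)
              · have := ho c hca
                simp [List.count_cons, hdc] at this; omega
              · have := ho d hda
                simp [List.count_cons, Ne.symm hdc] at this; omega

theorem count_base (n k x : ℕ) :
    (baseWord n k).count x = if 1 ≤ x ∧ x ≤ n then k else 0 := by
  induction n with
  | zero => simp [baseWord]; omega
  | succ n ih =>
    have : baseWord (n + 1) k = baseWord n k ++ List.replicate k (n + 1) := by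
      simp [baseWord, List.range_succ]
    rw [this, List.count_append, ih, List.count_replicate]
    by_cases h : n + 1 = x
    · subst h; simp
    · simp only [beq_iff_eq, h, if_false]; split_ifs <;> omega

theorem mem_mp (n k : ℕ) (w : List ℕ) : w ∈ multiPerms n k ↔
    ∀ x, w.count x = if 1 ≤ x ∧ x ≤ n then k else 0 := by
  simp only [multiPerms, List.mem_toFinset, List.mem_permutations, List.perm_iff_count, count_base]

theorem mem_mp1 (n : ℕ) (w : List ℕ) : w ∈ multiPerms n 1 ↔
    w.Nodup ∧ ∀ x, x ∈ w ↔ 1 ≤ x ∧ x ≤ n := by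
  rw [mem_mp]
  constructor
  · intro h
    constructor
    · rw [List.nodup_iff_count_le_one]
      intro a; rw [h a]; split_ifs <;> omega
    · intro x
      rw [← List.count_pos_iff, h x]; split_ifs with h1 <;> simp [h1]
  · rintro ⟨h1, h2⟩ x
    rw [h1.count]
    simp only [h2]

theorem len_mp1 (n : ℕ) (w : List ℕ) (h : w ∈ multiPerms n 1) : w.length = n := by
  simp only [multiPerms, List.mem_toFinset, List.mem_permutations] at h
  rw [h.length_eq]; simp [baseWord]

/-- Words with given order of values. -/
noncomputable def WW (m : ℕ) : List ℕ → Finset (List ℕ)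
  | [] => ∅
  | a :: r => (TT m a r).image (fun t => List.replicate (m + 2) a ++ t)

theorem WW_dedup (m : ℕ) (σ w : List ℕ) (h : σ.Nodup) (hw : w ∈ WW m σ) : w.dedup = σ := by
  cases σ with
  | nil => simp [WW] at hw
  | cons a r =>
    simp only [WW, Finset.mem_image] at hw
    obtain ⟨t, ht, rfl⟩ := hw
    have := TT_dedup m r a h t ht
    rw [dedup_rep, this]
    rw [← List.mem_dedup, this]; simp

theorem WW_sum (m : ℕ) (σ : List ℕ) (h : σ.Nodup) (h0 : σ ≠ []) :
    ∑ t ∈ WW m σ, (Polynomial.X : Polynomial ℚ) ^ des t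
      = (1 + Polynomial.X) ^ (σ.length - 1) * Polynomial.X ^ des σ := by
  cases σ with
  | nil => simp at h0
  | cons a r =>
    rw [WW, Finset.sum_image (by intro x _ y _ hxy; simpa using hxy)]
    simp only [List.replicate_succ (n := m + 1), List.cons_append, des_rep]
    rw [TT_sum m r a h]; simp

theorem Ank_eq (n m : ℕ) (hn : 1 ≤ n) : Ank n (m + 3) = (multiPerms n 1).biUnion (WW m) := by
  ext w
  simp only [Ank, Finset.mem_filter, Finset.mem_biUnion, avoids_iff_s18]
  constructor
  · rintro ⟨hw, hav⟩
    have hmem : ∀ x, x ∈ w ↔ 1 ≤ x ∧ x ≤ n := by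
      intro x
      rw [mem_mp] at hw
      rw [← List.count_pos_iff, hw x]; split_ifs with h1 <;> simp [h1]
    refine ⟨w.dedup, ?_, ?_⟩
    · rw [mem_mp1]
      exact ⟨List.nodup_dedup w, by simpa using hmem⟩
    · rw [mem_mp] at hw
      have hw' : ∀ x, w.count x = 0 ∨ w.count x = m + 3 := by
        intro x; rw [hw x]; split_ifs <;> simp
      cases w with
      | nil => have := (hmem 1).2 ⟨le_rfl, hn⟩; simp at this
      | cons a Y =>
        have hoY : ∀ x, x ≠ a → Y.count x = 0 ∨ Y.count x = m + 3 := by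
          intro x hx; have := hw' x; simpa [List.count_cons, Ne.symm hx] using this
        have hcY : Y.count a = m + 1 + 1 := by
          have := hw' a; simp at this; omega
        obtain ⟨v, rfl⟩ := peel (m + 1) a Y hav hcY (by intro x h; have := hoY x h; omega)
        have hv : v.count a = 1 := by simp [List.count_append] at hcY; omega
        have hov : ∀ x, x ≠ a → v.count x = 0 ∨ v.count x = m + 3 := by
          intro x h; have := hoY x h
          simpa [List.count_append, List.count_replicate, Ne.symm h] using this
        obtain ⟨r, h1, h2⟩ := classify m _ v a le_rfl hv hov
          (av_sub ((List.sublist_append_right _ _).cons_cons a) hav)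
        have e : a :: (List.replicate (m + 1) a ++ v) = List.replicate (m + 2) a ++ v := by
          simp [List.replicate_succ]
        have hav' : a ∈ v := by rw [← List.mem_dedup, h1]; simp
        rw [e, dedup_rep _ _ _ hav', h1]
        simp only [WW, Finset.mem_image]
        exact ⟨v, h2, rfl⟩
  · rintro ⟨σ, hσ, hw⟩
    rw [mem_mp1] at hσ
    obtain ⟨hnd, hm⟩ := hσ
    cases σ with
    | nil => simp [WW] at hw
    | cons a r =>
      simp only [WW, Finset.mem_image] at hw
      obtain ⟨t, ht, rfl⟩ := hw
      refine ⟨?_, TT_av m r a hnd t ht⟩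
      rw [mem_mp]
      intro x
      rw [List.count_append, List.count_replicate, TT_count m r a hnd t ht x]
      simp only [← hm x, List.mem_cons, beq_iff_eq]
      by_cases h : x = a
      · simp [h]
      · simp [h, Ne.symm h]

theorem main_sum (n m : ℕ) (hn : 1 ≤ n) :
    ∑ π ∈ Ank n (m + 3), (Polynomial.X : Polynomial ℚ) ^ des π
        = (1 + Polynomial.X) ^ (n - 1) *
          ∑ σ ∈ multiPerms n 1, (Polynomial.X : Polynomial ℚ) ^ des σ := by
  rw [Ank_eq n m hn, Finset.sum_biUnion, Finset.mul_sum]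
  · apply Finset.sum_congr rfl
    intro σ hσ
    have hl := len_mp1 n σ hσ
    rw [WW_sum m σ ((mem_mp1 n σ).1 hσ).1 (by rintro rfl; simp at hl; omega), hl]
  · intro σ hσ τ hτ hne
    rw [Function.onFun, Finset.disjoint_left]
    intro w h1 h2
    apply hne
    rw [← WW_dedup m σ w ((mem_mp1 n σ).1 hσ).1 h1, WW_dedup m τ w ((mem_mp1 n τ).1 hτ).1 h2]

theorem des_compl (n : ℕ) (l : List ℕ) : ∀ a, (a :: l).Nodup → (∀ x ∈ a :: l, x ≤ n) →
    des ((a :: l).map (fun x => n + 1 - x)) + des (a :: l) = l.length := by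
  induction l with
  | nil => intro a _ _; simp [des_single]
  | cons b l ih =>
    intro a hnd hle
    have h := ih b (by simp at hnd ⊢; tauto) (fun x hx => hle x (List.mem_cons_of_mem _ hx))
    have ha := hle a (by simp)
    have hb := hle b (by simp)
    have hab : a ≠ b := by simp at hnd; tauto
    simp only [List.map_cons] at h ⊢
    rw [des_cons_cons, des_cons_cons, List.length_cons]
    split_ifs <;> omega

theorem des_compl' (n : ℕ) (hn : 1 ≤ n) (σ : List ℕ) (h : σ ∈ multiPerms n 1) :
    des (σ.map (fun x => n + 1 - x)) + des σ = n - 1 := by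
  have hl := len_mp1 n σ h
  rw [mem_mp1] at h
  cases σ with
  | nil => simp at hl; omega
  | cons a l =>
    rw [des_compl n l a h.1 (fun x hx => ((h.2 x).1 hx).2)]
    simp at hl; omega

theorem compl_mem (n : ℕ) (σ : List ℕ) (h : σ ∈ multiPerms n 1) :
    σ.map (fun x => n + 1 - x) ∈ multiPerms n 1 := by
  rw [mem_mp1] at h ⊢
  constructor
  · apply List.Nodup.map_on _ h.1
    intro x hx y hy hxy
    have := (h.2 x).1 hx
    have := (h.2 y).1 hy
    omega
  · intro x
    rw [List.mem_map]
    constructor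
    · rintro ⟨y, hy, rfl⟩
      have := (h.2 y).1 hy
      omega
    · intro hx
      exact ⟨n + 1 - x, (h.2 _).2 (by omega), by omega⟩

theorem compl_compl_map (n : ℕ) (σ : List ℕ) (h : σ ∈ multiPerms n 1) :
    (σ.map (fun x => n + 1 - x)).map (fun x => n + 1 - x) = σ := by
  rw [mem_mp1] at h
  rw [List.map_map]
  conv_rhs => rw [← List.map_id σ]
  apply List.map_congr_left
  intro x hx
  have := (h.2 x).1 hx
  simp; omega

theorem reflect_sum {ι : Type} (s : Finset ι) (N : ℕ) (f : ι → Polynomial ℚ) :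
    Polynomial.reflect N (∑ i ∈ s, f i) = ∑ i ∈ s, Polynomial.reflect N (f i) := by
  induction s using Finset.induction_on with
  | empty => simp
  | insert a s ha ih => rw [Finset.sum_insert ha, Finset.sum_insert ha, Polynomial.reflect_add, ih]

theorem reflect_X (N d : ℕ) (h : d ≤ N) :
    Polynomial.reflect N ((Polynomial.X : Polynomial ℚ) ^ d) = Polynomial.X ^ (N - d) := by
  have := Polynomial.reflect_C_mul_X_pow (R := ℚ) (c := 1) N d
  rw [Polynomial.revAt_le h] at this
  simpa using this

theorem reflect_A (n : ℕ) (hn : 1 ≤ n) :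
    Polynomial.reflect (n - 1) (∑ σ ∈ multiPerms n 1, (Polynomial.X : Polynomial ℚ) ^ des σ)
      = ∑ σ ∈ multiPerms n 1, (Polynomial.X : Polynomial ℚ) ^ des σ := by
  rw [reflect_sum]
  refine Finset.sum_nbij' (fun σ => σ.map (fun x => n + 1 - x))
    (fun σ => σ.map (fun x => n + 1 - x)) (compl_mem n) (compl_mem n)
    (compl_compl_map n) (compl_compl_map n) ?_
  intro σ hσ
  have := des_compl' n hn σ hσ
  rw [reflect_X _ _ (by omega)]
  congr 1; omega

theorem deg_B (N : ℕ) : ((1 + Polynomial.X : Polynomial ℚ) ^ N).natDegree ≤ N := by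
  have : (1 + Polynomial.X : Polynomial ℚ).natDegree ≤ 1 := by compute_degree
  calc _ ≤ N * _ := Polynomial.natDegree_pow_le
    _ ≤ N * 1 := Nat.mul_le_mul_left _ this
    _ = N := by ring

theorem reflect_B (N : ℕ) : Polynomial.reflect N ((1 + Polynomial.X : Polynomial ℚ) ^ N)
    = (1 + Polynomial.X) ^ N := by
  induction N with
  | zero => simpa using reflect_X 0 0 le_rfl
  | succ N ih =>
    rw [pow_succ, Polynomial.reflect_mul _ _ (deg_B N) (by simpa using deg_B 1), ih]
    congr 1
    have h0 := reflect_X 1 0 (by omega)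
    have h1 := reflect_X 1 1 (by omega)
    simp only [pow_zero, pow_one, Nat.sub_zero, Nat.sub_self] at h0 h1
    rw [Polynomial.reflect_add, h0, h1, add_comm]

theorem coeff_card (s : Finset (List ℕ)) (r : ℕ) :
    (∑ π ∈ s, (Polynomial.X : Polynomial ℚ) ^ des π).coeff r
      = ((s.filter (fun π => des π = r)).card : ℚ) := by
  rw [Polynomial.finsetSum_coeff, Finset.card_filter]
  push_cast
  apply Finset.sum_congr rfl
  intro π _
  rw [Polynomial.coeff_X_pow]
  by_cases h : des π = r
  · simp [h]
  · simp [h, Ne.symm h]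

/-- For k ≥ 3 and n ≥ 1, the descent polynomial of A_n^k is (1+t)^{n-1} A_n(t),
which is palindromic: the number of words with r descents equals the number with
2n - 2 - r descents. -/
theorem Ank_descent_polynomial (n k : ℕ) (hk : 3 ≤ k) (hn : 1 ≤ n) :
    (∑ π ∈ Ank n k, (Polynomial.X : Polynomial ℚ) ^ des π
        = (1 + Polynomial.X) ^ (n - 1) * ∑ σ ∈ multiPerms n 1, (Polynomial.X : Polynomial ℚ) ^ des σ)
    ∧ ∀ r, r ≤ 2 * n - 2 →
        ((Ank n k).filter (fun π => des π = r)).card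
          = ((Ank n k).filter (fun π => des π = 2 * n - 2 - r)).card := by
  obtain ⟨m, rfl⟩ : ∃ m, k = m + 3 := ⟨k - 3, by omega⟩
  refine ⟨main_sum n m hn, ?_⟩
  intro r hr
  have hdA : (∑ σ ∈ multiPerms n 1, (Polynomial.X : Polynomial ℚ) ^ des σ).natDegree ≤ n - 1 := by
    apply Polynomial.natDegree_sum_le_of_forall_le
    intro σ hσ
    have := des_compl' n hn σ hσ
    rw [Polynomial.natDegree_X_pow]; omega
  have hrefl : Polynomial.reflect (2 * n - 2)
      (∑ π ∈ Ank n (m + 3), (Polynomial.X : Polynomial ℚ) ^ des π)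
      = ∑ π ∈ Ank n (m + 3), (Polynomial.X : Polynomial ℚ) ^ des π := by
    rw [main_sum n m hn, show 2 * n - 2 = (n - 1) + (n - 1) by omega,
      Polynomial.reflect_mul _ _ (deg_B _) hdA, reflect_B, reflect_A n hn]
  have h := congrArg (fun p => Polynomial.coeff p r) hrefl
  simp only [Polynomial.coeff_reflect, Polynomial.revAt_le hr] at h
  rw [coeff_card, coeff_card] at h
  exact_mod_cast h.symm
end
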